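/- arXiv:2508.15273 — 12 statements merged into one kernel-verified Lean document; each statement's English description precedes it below -/
import Mathlib

section
/- Let A be a real n×n matrix. If some principal submatrix A[κ] of A is Hurwitz-stable but is not a P⁻₀ matrix, then A is D-Hopf. -/
open Matrix

/-- Principal submatrix of `A` on the index set `κ`. -/
def psub {m : Type*} (A : Matrix m m ℝ) (κ : Finset m) : Matrix κ κ ℝ :=
  A.submatrix (fun i => (i : m)) (fun i => (i : m))

/-- The multiset of complex eigenvalues (roots of the characteristic polynomial over ℂ,
with algebraic multiplicity) of a real square matrix. -/
noncomputable def spec {m : Type*} [Fintype m] [DecidableEq m] (A : Matrix m m ℝ) : Multiset ℂ :=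
  ((A.map (Complex.ofReal)).charpoly).roots

open scoped Classical in
/-- The inertia of a real square matrix: the numbers of complex eigenvalues (with algebraic
multiplicity) with negative, positive and zero real part, respectively. -/
noncomputable def inertia {m : Type*} [Fintype m] [DecidableEq m] (A : Matrix m m ℝ) :
    ℕ × ℕ × ℕ :=
  (Multiset.card ((spec A).filter fun z => z.re < 0),
   Multiset.card ((spec A).filter fun z => 0 < z.re),
   Multiset.card ((spec A).filter fun z => z.re = 0))

/-- A real square matrix is Hurwitz-stable if all its complex eigenvalues have
negative real part. -/
def HurwitzStable {m : Type*} [Fintype m] [DecidableEq m] (A : Matrix m m ℝ) : Prop :=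
  ∀ z ∈ spec A, z.re < 0

/-- A real square matrix is Hurwitz-unstable if some complex eigenvalue has
positive real part. -/
def HurwitzUnstable {m : Type*} [Fintype m] [DecidableEq m] (A : Matrix m m ℝ) : Prop :=
  ∃ z ∈ spec A, 0 < z.re

/-- A real square matrix `A` is D-Hopf if there is a principal submatrix `A[κ]` that is
invertible and two positive diagonal matrices `D₁`, `D₂` such that the inertias of
`A[κ]·D₁` and `A[κ]·D₂` differ. -/
def IsDHopf {m : Type*} [Fintype m] [DecidableEq m] (A : Matrix m m ℝ) : Prop :=
  ∃ κ : Finset m, (psub A κ).det ≠ 0 ∧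
    ∃ d₁ d₂ : κ → ℝ, (∀ i, 0 < d₁ i) ∧ (∀ i, 0 < d₂ i) ∧
      inertia (psub A κ * Matrix.diagonal d₁) ≠ inertia (psub A κ * Matrix.diagonal d₂)

/-- A real square matrix is a `P⁻₀` matrix if every nonzero `k`-principal minor has
sign `(−1)ᵏ`. -/
def IsPMinusZero {m : Type*} [Fintype m] [DecidableEq m] (A : Matrix m m ℝ) : Prop :=
  ∀ κ : Finset m, (psub A κ).det ≠ 0 → 0 < (-1 : ℝ) ^ κ.card * (psub A κ).det

theorem aux_charpoly_pos {m : Type*} [Fintype m] [DecidableEq m] (M : Matrix m m ℝ)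
    (h : HurwitzStable M) (x : ℝ) (hx : 0 ≤ x) : 0 < M.charpoly.eval x := by
  have hne : ∀ y : ℝ, 0 ≤ y → M.charpoly.eval y ≠ 0 := by
    intro y hy h0
    have h1 : ((y : ℂ)) ∈ spec M := by
      unfold spec
      rw [Polynomial.mem_roots (Matrix.charpoly_monic _).ne_zero]
      have h2 : (M.map Complex.ofReal).charpoly = M.charpoly.map Complex.ofRealHom :=
        Matrix.charpoly_map M Complex.ofRealHom
      rw [h2, Polynomial.IsRoot.def]
      have h3 := Polynomial.eval_map_apply (p := M.charpoly) (f := Complex.ofRealHom) y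
      rw [h0] at h3
      simpa using h3
    have := h _ h1
    simp at this
    linarith
  by_contra hcon
  push Not at hcon
  by_cases hd : 0 < M.charpoly.degree
  · have ht := M.charpoly.tendsto_atTop_of_leadingCoeff_nonneg hd
      (by rw [(Matrix.charpoly_monic M).leadingCoeff]; norm_num)
    obtain ⟨y, hy0, hyx⟩ := ((ht.eventually_ge_atTop 0).and
      (Filter.eventually_ge_atTop x)).exists
    obtain ⟨z, hz, hz0⟩ := intermediate_value_Icc hyx
      (M.charpoly.continuous.continuousOn) ⟨hcon, hy0⟩
    exact hne z (hx.trans hz.1) hz0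
  · have h1 : M.charpoly = 1 := by
      apply Polynomial.eq_one_of_monic_natDegree_zero (Matrix.charpoly_monic M)
      exact Polynomial.natDegree_eq_zero_iff_degree_le_zero.2 (not_lt.1 hd)
    rw [h1] at hcon
    simp at hcon
    linarith

theorem aux_stable_of_inertia {m : Type*} [Fintype m] [DecidableEq m] (M N : Matrix m m ℝ)
    (h : HurwitzStable M) (hi : inertia M = inertia N) : HurwitzStable N := by
  classical
  have hc : ∀ K : Matrix m m ℝ, Multiset.card (spec K) = Fintype.card m := by
    intro K
    unfold spec
    rw [IsAlgClosed.card_roots_eq_natDegree, Matrix.charpoly_natDegree_eq_dim]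
  unfold inertia at hi
  have h1 := (Prod.ext_iff.1 hi).1
  simp only at h1
  rw [Multiset.filter_eq_self.2 h, hc M, ← hc N] at h1
  have h2 := Multiset.eq_of_le_of_card_le (Multiset.filter_le _ _) h1.le
  exact Multiset.filter_eq_self.1 h2

theorem aux_main {m : Type*} [Fintype m] [DecidableEq m] (B : Matrix m m ℝ)
    (h : ∀ d : m → ℝ, (∀ i, 0 < d i) → HurwitzStable (B * Matrix.diagonal d)) (τ : Finset m) :
    0 ≤ (-1 : ℝ) ^ τ.card * (psub B τ).det := by
  let a : ℝ → m → ℝ := fun ε i => if i ∈ τ then ε else 1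
  let b : ℝ → m → ℝ := fun ε i => if i ∈ τ then 1 else ε
  let f : ℝ → ℝ := fun ε => (Matrix.diagonal (a ε) - B * Matrix.diagonal (b ε)).det
  have hf : Continuous f := by
    have ha : Continuous a := by
      refine continuous_pi fun i => ?_
      by_cases hi : i ∈ τ <;> simp only [a, hi, if_true, if_false] <;> fun_prop
    have hb : Continuous b := by
      refine continuous_pi fun i => ?_
      by_cases hi : i ∈ τ <;> simp only [b, hi, if_true, if_false] <;> fun_prop
    apply Continuous.matrix_det
    exact ha.matrix_diagonal.sub (continuous_const.matrix_mul hb.matrix_diagonal)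
  have hpos : ∀ ε : ℝ, 0 < ε → 0 ≤ f ε := by
    intro ε hε
    have ha : ∀ i, 0 < a ε i := by intro i; simp only [a]; split_ifs <;> linarith
    have hb : ∀ i, 0 < b ε i := by intro i; simp only [b]; split_ifs <;> linarith
    have h1 := aux_charpoly_pos _ (h (fun i => b ε i / a ε i) fun i => div_pos (hb i) (ha i)) 1
      zero_le_one
    rw [Matrix.eval_charpoly] at h1
    have h2 : Matrix.diagonal (a ε) - B * Matrix.diagonal (b ε) =
        (Matrix.scalar m (1 : ℝ) - B * Matrix.diagonal (fun i => b ε i / a ε i)) *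
          Matrix.diagonal (a ε) := by
      rw [sub_mul, Matrix.mul_assoc, Matrix.diagonal_mul_diagonal]
      have : (fun i => b ε i / a ε i * a ε i) = b ε := by
        funext i
        exact div_mul_cancel₀ _ (ha i).ne'
      rw [this]
      simp
    simp only [f]
    rw [h2, Matrix.det_mul, Matrix.det_diagonal]
    exact (mul_pos h1 (Finset.prod_pos fun i _ => ha i)).le
  have h0 : 0 ≤ f 0 := by
    have ht : Filter.Tendsto f (nhdsWithin 0 (Set.Ioi 0)) (nhds (f 0)) :=
      (hf.tendsto 0).mono_left nhdsWithin_le_nhds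
    exact ge_of_tendsto ht (Filter.eventually_of_mem self_mem_nhdsWithin fun ε hε => hpos ε hε)
  have he : f 0 = (-1 : ℝ) ^ τ.card * (psub B τ).det := by
    simp only [f]
    rw [Matrix.twoBlockTriangular_det' _ (fun i => i ∈ τ)]
    · have e1 : Matrix.toSquareBlockProp (Matrix.diagonal (a 0) - B * Matrix.diagonal (b 0))
          (fun i => i ∈ τ) = - psub B τ := by
        ext i j
        by_cases hij : (i : m) = j <;>
        simp [Matrix.toSquareBlockProp, psub, a, b, Matrix.mul_diagonal, Matrix.diagonal_apply, hij]
      have e2 : Matrix.toSquareBlockProp (Matrix.diagonal (a 0) - B * Matrix.diagonal (b 0))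
          (fun i => ¬ i ∈ τ) = 1 := by
        ext i j
        have hj := j.2
        have hi := i.2
        simp [Matrix.toSquareBlockProp, a, b, Matrix.mul_diagonal, Matrix.diagonal_apply, hj, hi,
          Matrix.one_apply, Subtype.ext_iff]
      rw [e1, e2, Matrix.det_one, mul_one]
      have := Matrix.det_neg (psub B τ)
      rw [Fintype.card_coe] at this
      rw [← this]
      congr!
    · intro i hi j hj
      have hij : i ≠ j := by rintro rfl; exact hj hi
      simp [Matrix.mul_diagonal, b, hj, hij]
  rwa [he] at h0

/-- If some principal submatrix `A[κ]` of a real `n×n` matrix `A` is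
Hurwitz-stable but is not a `P⁻₀` matrix, then `A` is D-Hopf. -/
theorem isDHopf_of_stable_not_pminuszero {n : ℕ} (A : Matrix (Fin n) (Fin n) ℝ)
    (κ : Finset (Fin n)) (hstab : HurwitzStable (psub A κ))
    (hP : ¬ IsPMinusZero (psub A κ)) : IsDHopf A := by
  refine ⟨κ, ?_, ?_⟩
  · intro h0
    have := aux_charpoly_pos _ hstab 0 le_rfl
    rw [Matrix.eval_charpoly] at this
    simp [Matrix.det_neg, h0] at this
  · by_contra hcon
    push Not at hcon
    apply hP
    intro τ hτ
    refine lt_of_le_of_ne (aux_main _ ?_ τ) (mul_ne_zero (by simp) hτ).symm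
    intro d hd
    refine aux_stable_of_inertia (psub A κ) _ hstab ?_
    have := hcon (fun _ => 1) d (fun _ => one_pos) hd
    simpa using this
end

section
/- Let A be a real n×n matrix such that sign(det A) = (−1)ⁿ and such that A has a Hurwitz-stable (n−1)×(n−1) principal submatrix. Then there exists an n×n positive diagonal matrix D such that A·D is Hurwitz-stable. -/
open Matrix

lemma mem_spec_iff {m : Type*} [Fintype m] [DecidableEq m] (A : Matrix m m ℝ) (z : ℂ) :
    z ∈ spec A ↔ (Matrix.scalar m z - A.map Complex.ofReal).det = 0 := by
  unfold spec
  rw [Polynomial.mem_roots (Matrix.charpoly_monic _).ne_zero, Polynomial.IsRoot.def,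
    Matrix.eval_charpoly]

lemma monic_pos {Q : Polynomial ℝ} (hQ : Q.Monic) (h : ∀ x : ℝ, 0 ≤ x → Q.eval x ≠ 0) :
    0 < Q.eval 0 := by
  by_contra hc
  push Not at hc
  by_cases hd : Q.natDegree = 0
  · rw [hQ.natDegree_eq_zero.mp hd] at hc
    norm_num at hc
  · have ht := Polynomial.tendsto_atTop_of_leadingCoeff_nonneg Q
      (Polynomial.natDegree_pos_iff_degree_pos.mp (Nat.pos_of_ne_zero hd))
      (by rw [hQ.leadingCoeff]; norm_num)
    obtain ⟨b, hb1, hb2⟩ := ((ht.eventually_ge_atTop 0).and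
      (Filter.eventually_ge_atTop 0)).exists
    obtain ⟨x, hx, hx0⟩ := intermediate_value_Icc hb2 Q.continuous.continuousOn ⟨hc, hb1⟩
    exact h x hx.1 hx0

section
attribute [local instance] Matrix.linftyOpNormedRing Matrix.linftyOpNormedAlgebra

lemma spec_bound {n : ℕ} (A : Matrix (Fin n) (Fin n) ℝ) : ∃ R : ℝ, ∀ d : Fin n → ℝ,
    (∀ i, 0 < d i) → (∀ i, d i ≤ 1) → ∀ z ∈ spec (A * Matrix.diagonal d), ‖z‖ ≤ R := by
  rcases Nat.eq_zero_or_pos n with rfl | hn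
  · refine ⟨0, fun d _ _ z hz => ?_⟩
    rw [mem_spec_iff] at hz
    simp at hz
  haveI : Nonempty (Fin n) := ⟨⟨0, hn⟩⟩
  refine ⟨‖A.map Complex.ofReal‖, fun d h0 h1 z hz => ?_⟩
  unfold spec at hz
  have hz' := Polynomial.isRoot_of_mem_roots hz
  rw [← Matrix.mem_spectrum_iff_isRoot_charpoly] at hz'
  refine (spectrum.norm_le_norm_of_mem hz').trans ?_
  have : (A * Matrix.diagonal d).map Complex.ofReal
      = A.map Complex.ofReal * Matrix.diagonal (fun i => (d i : ℂ)) := by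
    ext i j
    simp [Matrix.mul_diagonal]
  rw [this]
  refine (norm_mul_le _ _).trans ?_
  refine mul_le_of_le_one_right (norm_nonneg _) ?_
  rw [Matrix.linfty_opNorm_diagonal, pi_norm_le_iff_of_nonneg zero_le_one]
  intro i
  rw [Complex.norm_real, Real.norm_eq_abs, abs_of_pos (h0 i)]
  exact h1 i
end

lemma q_eq {m : ℕ} (A : Matrix (Fin (m+1)) (Fin (m+1)) ℝ) (i : Fin (m+1)) (z : ℂ) :
    ((Matrix.scalar (Fin (m+1)) z - A.map Complex.ofReal).updateCol i (Pi.single i 1)).det =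
      (Matrix.scalar _ z - (psub A {i}ᶜ).map Complex.ofReal).det := by
  rw [Matrix.det_succ_column _ i, Finset.sum_eq_single i]
  · rw [← two_mul, pow_mul]
    simp only [even_two, Even.neg_pow, one_pow, Matrix.updateCol_self, Pi.single_eq_same, one_mul,
      Matrix.submatrix_updateCol_succAbove]
    let e : Fin m ≃ ({i}ᶜ : Finset (Fin (m+1))) :=
      (finSuccAboveEquiv i).trans (Equiv.subtypeEquivRight (by intro x; simp))
    have he : ∀ k, ((e k : Fin (m+1))) = i.succAbove k := fun k => rfl
    rw [← Matrix.det_submatrix_equiv_self e]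
    congr 1
    ext k l
    by_cases hkl : k = l
    · subst hkl
      simp [psub, he]
    · simp [psub, he, Matrix.diagonal_apply, hkl]
  · intro j _ hj
    simp [hj]
  · simp

/-- Let `A` be a real `n×n` matrix such that `sign (det A) = (−1)ⁿ` and
such that `A` has a Hurwitz-stable `(n−1)×(n−1)` principal submatrix. Then there exists a
positive `n×n` diagonal matrix `D` such that `A·D` is Hurwitz-stable. -/
theorem exists_posdiag_hurwitzStable {n : ℕ} (A : Matrix (Fin n) (Fin n) ℝ)
    (hdet : 0 < (-1 : ℝ) ^ n * A.det)
    (hsub : ∃ κ : Finset (Fin n), κ.card = n - 1 ∧ HurwitzStable (psub A κ)) :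
    ∃ d : Fin n → ℝ, (∀ i, 0 < d i) ∧ HurwitzStable (A * Matrix.diagonal d) := by
  rcases n with _ | m
  · refine ⟨fun _ => 1, fun _ => one_pos, fun z hz => ?_⟩
    rw [mem_spec_iff] at hz
    simp at hz
  obtain ⟨κ, hκ, hst⟩ := hsub
  obtain ⟨i, rfl⟩ : ∃ i, κ = {i}ᶜ := by
    have : κᶜ.card = 1 := by rw [Finset.card_compl, hκ]; simp
    obtain ⟨i, hi⟩ := Finset.card_eq_one.mp this
    exact ⟨i, by rw [← hi, compl_compl]⟩
  set N : ℂ → Matrix (Fin (m+1)) (Fin (m+1)) ℂ :=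
    fun z => Matrix.scalar (Fin (m+1)) z - A.map Complex.ofReal with hN
  set q : ℂ → ℂ := fun z => ((N z).updateCol i (Pi.single i 1)).det with hq
  set a : Fin (m+1) → ℂ := fun k => (A k i : ℂ) with ha
  set r : ℂ → ℂ := fun z => ((N z).updateCol i (-a)).det with hr
  have hNc : Continuous N := by
    refine Continuous.sub ?_ continuous_const
    exact Continuous.matrix_diagonal (continuous_pi fun _ => continuous_id)
  have hqc : Continuous q := (hNc.matrix_updateCol i continuous_const).matrix_det
  have hrc : Continuous r := (hNc.matrix_updateCol i continuous_const).matrix_det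
  have hqne : ∀ z : ℂ, 0 ≤ z.re → q z ≠ 0 := by
    intro z hz h0
    have : q z = _ := q_eq A i z
    rw [this, ← mem_spec_iff] at h0
    exact absurd (hst z h0) (not_lt.mpr hz)
  have hqreal : ∀ x : ℝ, q x = (((psub A {i}ᶜ).charpoly.eval x : ℝ) : ℂ) := by
    intro x
    have : q x = _ := q_eq A i x
    rw [this, ← Matrix.eval_charpoly]
    have := Matrix.charpoly_map (psub A {i}ᶜ) Complex.ofRealHom
    erw [this]
    simp [Polynomial.eval_map, Polynomial.eval₂_at_apply]
    exact Polynomial.eval₂_at_apply Complex.ofRealHom x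
  have hq0 : 0 < (psub A {i}ᶜ).charpoly.eval 0 := by
    refine monic_pos (Matrix.charpoly_monic _) fun x hx h0 => ?_
    refine hqne x (by simpa using hx) ?_
    rw [hqreal, h0, Complex.ofReal_zero]
  have hr0 : r 0 = (((-1 : ℝ) ^ (m+1) * A.det : ℝ) : ℂ) := by
    have h1 : (N 0).updateCol i (-a) = -(A.map Complex.ofReal) := by
      ext k l
      by_cases hl : l = i
      · subst hl; simp [ha]
      · simp [hN, hl]
    have h2 : (A.map Complex.ofReal).det = (A.det : ℂ) := (RingHom.map_det Complex.ofRealHom A).symm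
    simp only [hr]
    rw [h1, Matrix.det_neg, h2]
    simp
  have hf0 : 0 < (r 0 / q 0).re := by
    have := hqreal 0
    rw [Complex.ofReal_zero] at this
    rw [hr0, this, ← Complex.ofReal_div, Complex.ofReal_re]
    exact div_pos hdet hq0
  have hfc : ∀ z : ℂ, 0 ≤ z.re → ContinuousAt (fun z => r z / q z) z := fun z hz =>
    hrc.continuousAt.div hqc.continuousAt (hqne z hz)
  obtain ⟨δ, hδ, hball⟩ : ∃ δ > 0, ∀ z : ℂ, ‖z‖ < δ → 0 < (r z / q z).re := by
    have h1 : ContinuousAt (fun z => (r z / q z).re) 0 :=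
      Complex.continuous_re.continuousAt.comp (hfc 0 (by simp))
    obtain ⟨δ, hδ, h⟩ := Metric.eventually_nhds_iff.mp (h1.eventually_const_lt hf0)
    exact ⟨δ, hδ, fun z hz => h (by simpa using hz)⟩
  obtain ⟨R, hR⟩ := spec_bound A
  have hK : IsCompact (Metric.closedBall (0:ℂ) R ∩ {z : ℂ | 0 ≤ z.re}) :=
    (isCompact_closedBall _ _).inter_right (isClosed_le continuous_const Complex.continuous_re)
  obtain ⟨C, hC⟩ := hK.exists_bound_of_continuousOn (f := fun z => r z / q z)
    (fun z hz => (hfc z hz.2).continuousWithinAt)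
  set ε : ℝ := min 1 (δ / (|C| + 1)) with hε
  have hεpos : 0 < ε := lt_min one_pos (by positivity)
  have hε1 : ε ≤ 1 := min_le_left _ _
  have hε2 : ε * |C| < δ := by
    have h1 : ε * (|C| + 1) ≤ δ := (le_div_iff₀ (by positivity)).mp (min_le_right _ _)
    linarith
  have hd0 : ∀ j, 0 < Function.update (fun _ : Fin (m+1) => (1:ℝ)) i ε j := by
    intro j
    by_cases hj : j = i
    · subst hj; simpa using hεpos
    · simp [hj]
  have hd1 : ∀ j, Function.update (fun _ : Fin (m+1) => (1:ℝ)) i ε j ≤ 1 := by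
    intro j
    by_cases hj : j = i
    · subst hj; simpa using hε1
    · simp [hj]
  refine ⟨_, hd0, fun z hz => ?_⟩
  by_contra hre
  push Not at hre
  have hzR := hR _ hd0 hd1 z hz
  have hzC := hC z ⟨by simpa using hzR, hre⟩
  rw [mem_spec_iff] at hz
  have hmat : Matrix.scalar (Fin (m+1)) z -
      (A * Matrix.diagonal (Function.update (fun _ : Fin (m+1) => (1:ℝ)) i ε)).map Complex.ofReal
      = (N z).updateCol i (z • Pi.single i 1 + (ε : ℂ) • (-a)) := by
    ext k l
    by_cases hl : l = i
    · subst hl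
      by_cases hk : k = l
      · subst hk; simp [ha, Matrix.mul_diagonal]; ring
      · simp [ha, Matrix.mul_diagonal, hk]; ring
    · simp [hN, hl, Matrix.mul_diagonal]
  rw [hmat, Matrix.det_updateCol_add, Matrix.det_updateCol_smul, Matrix.det_updateCol_smul] at hz
  have hz2 : z * q z + ε * r z = 0 := hz
  have hz3 : z = -(ε * (r z / q z)) := by
    have := hqne z hre
    field_simp
    linear_combination hz2
  have hzn : ‖z‖ < δ := by
    rw [hz3, norm_neg, norm_mul, Complex.norm_real, Real.norm_eq_abs, abs_of_pos hεpos]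
    refine lt_of_le_of_lt ?_ hε2
    exact mul_le_mul_of_nonneg_left (hzC.trans (le_abs_self C)) hεpos.le
  have hp := mul_pos hεpos (hball z hzn)
  have : z.re = -(ε * (r z / q z).re) := by
    conv_lhs => rw [hz3]
    rw [Complex.neg_re, Complex.re_ofReal_mul]
  linarith
end

section
/- Let A be a real n×n matrix having a principal submatrix A[κ] that is Hurwitz-unstable and is a P⁻_FF (Fisher–Fuller) matrix. Then A is D-Hopf. -/
open Matrix

/-- An `n×n` `P⁻₀` matrix is `P⁻_FF` (Fisher–Fuller) if there is a nested sequence of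
invertible principal submatrices `A[κ₁] ⊂ … ⊂ A[κₙ]` with `|κᵢ| = i`. -/
def IsPMinusFF {m : Type*} [Fintype m] [DecidableEq m] (A : Matrix m m ℝ) : Prop :=
  IsPMinusZero A ∧
    ∃ κ : Fin (Fintype.card m) → Finset m,
      (∀ i, (κ i).card = (i : ℕ) + 1) ∧
      (∀ i j, i ≤ j → κ i ⊆ κ j) ∧
      (∀ i, (psub A (κ i)).det ≠ 0)

section helpers
variable {m : Type*} [Fintype m] [DecidableEq m]

/-- Matrix with column `j` equal to `x e_j - d_j B_j` for `j ∈ s`, and `e_j` otherwise. -/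
def auxM (B : Matrix m m ℝ) (s : Finset m) (d : m → ℝ) (x : ℝ) : Matrix m m ℝ :=
  Matrix.of fun i j => if j ∈ s then (if i = j then x else 0) - d j * B i j
    else (if i = j then 1 else 0)

theorem auxM_cont (B : Matrix m m ℝ) (s : Finset m) (d : m → ℝ) :
    Continuous fun x => (auxM B s d x).det := by
  apply Continuous.matrix_det
  refine continuous_matrix fun i j => ?_
  simp only [auxM, Matrix.of_apply]
  split_ifs <;> fun_prop

theorem auxM_insert (B : Matrix m m ℝ) (s : Finset m) (d : m → ℝ) (j : m) (hj : j ∉ s)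
    (e x : ℝ) :
    (auxM B (insert j s) (Function.update d j e) x).det =
      x * (auxM B s d x).det + e * -((auxM B s d x).updateCol j (fun i => B i j)).det := by
  have h1 : auxM B (insert j s) (Function.update d j e) x =
      (auxM B s d x).updateCol j (x • (fun i => (auxM B s d x) i j) + (-e) • (fun i => B i j)) := by
    ext i k
    by_cases hk : k = j
    · subst hk
      simp [auxM, hj]
      ring
    · simp [auxM, Matrix.updateCol_apply, hk]
  rw [h1, Matrix.det_updateCol_add, Matrix.det_updateCol_smul, Matrix.det_updateCol_smul]
  have : (auxM B s d x).updateCol j (fun i => (auxM B s d x) i j) = auxM B s d x :=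
    Matrix.updateCol_eq_self _ _
  rw [this]
  ring

theorem auxM_zero (B : Matrix m m ℝ) (s : Finset m) (d : m → ℝ) :
    (auxM B s d 0).det = (-1) ^ s.card * (psub B s).det * ∏ j ∈ s, d j := by
  have h1 : auxM B s d 0 = (Matrix.of fun i j => if j ∈ s then B i j
      else (if i = j then 1 else 0)) * Matrix.diagonal (fun j => if j ∈ s then -d j else 1) := by
    ext i j
    rw [Matrix.mul_diagonal]
    simp only [auxM, Matrix.of_apply]
    split_ifs <;> ring
  have h2 : (Matrix.of fun i j => if j ∈ s then B i j
      else (if i = j then (1:ℝ) else 0)).det = (psub B s).det := by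
    rw [Matrix.twoBlockTriangular_det' _ (fun i => i ∈ s)]
    · have e1 : Matrix.toSquareBlockProp (Matrix.of fun i j => if j ∈ s then B i j
          else (if i = j then (1:ℝ) else 0)) (fun i => ¬ i ∈ s) = 1 := by
        ext i j
        simp [Matrix.toSquareBlockProp, Matrix.one_apply, j.2, Subtype.ext_iff]
      have e2 : Matrix.toSquareBlockProp (Matrix.of fun i j => if j ∈ s then B i j
          else (if i = j then (1:ℝ) else 0)) (fun i => i ∈ s) = psub B s := by
        ext i j
        simp [Matrix.toSquareBlockProp, psub, j.2]
      rw [e1, Matrix.det_one, mul_one, e2]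
      convert rfl
    · intro i hi j hj
      have : i ≠ j := by rintro rfl; exact hj hi
      simp [hj, this]
  rw [h1, Matrix.det_mul, h2, Matrix.det_diagonal, Finset.prod_ite]
  simp [Finset.prod_neg]
  ring

def Good (B : Matrix m m ℝ) (s : Finset m) : Prop :=
  ∃ d : m → ℝ, (∀ i, 0 < d i) ∧ ∃ x : ℕ → ℝ, x 0 = 0 ∧ (∀ i < s.card, x (i + 1) < x i) ∧
    ∀ i ≤ s.card, 0 < (-1) ^ i * (auxM B s d (x i)).det

theorem good_empty (B : Matrix m m ℝ) : Good B ∅ := by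
  refine ⟨fun _ => 1, by simp, fun _ => 0, rfl, by simp, ?_⟩
  intro i hi
  have : i = 0 := by simpa using hi
  subst this
  have : (psub B ∅).det = 1 := Matrix.det_isEmpty
  rw [auxM_zero]; simp [this]

open Filter Topology in
theorem good_insert (B : Matrix m m ℝ) (s : Finset m) (j : m) (hj : j ∉ s)
    (hdet : 0 < (-1) ^ (insert j s).card * (psub B (insert j s)).det)
    (h : Good B s) : Good B (insert j s) := by
  obtain ⟨d, hd, x, hx0, hx, hs⟩ := h
  -- choose the point close to zero
  have hδ : ∃ y < 0, 0 < (auxM B s d y).det ∧ (0 < s.card → x 1 < y) := by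
    have c1 : ∀ᶠ y in 𝓝[<] (0:ℝ), 0 < (auxM B s d y).det := by
      apply Filter.Eventually.filter_mono nhdsWithin_le_nhds
      have := hs 0 (Nat.zero_le _)
      rw [hx0] at this
      exact (auxM_cont B s d).continuousAt.eventually (lt_mem_nhds (by simpa using this))
    have c2 : ∀ᶠ y in 𝓝[<] (0:ℝ), (0 < s.card → x 1 < y) := by
      apply Filter.Eventually.filter_mono nhdsWithin_le_nhds
      by_cases hc : 0 < s.card
      · have := hx 0 hc
        rw [hx0] at this
        filter_upwards [lt_mem_nhds this] with y hy _ using hy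
      · simp [hc]
    obtain ⟨y, hy⟩ := (c1.and (c2.and self_mem_nhdsWithin)).exists
    exact ⟨y, hy.2.2, hy.1, hy.2.1⟩
  obtain ⟨y, hy0, hyp, hyx⟩ := hδ
  let z : ℕ → ℝ := fun i => match i with
    | 0 => 0
    | 1 => y
    | i + 2 => x (i + 1)
  have hneg : ∀ i, i < s.card → x (i + 1) < 0 := by
    intro i
    induction i with
    | zero => intro hi; have := hx 0 hi; rwa [hx0] at this
    | succ i ih => intro hi; exact (hx (i+1) hi).trans (ih (by omega))
  have hz : ∀ i ≤ s.card, 0 < (-1) ^ (i + 1) * (z (i + 1) * (auxM B s d (z (i + 1))).det) := by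
    intro i hi
    rcases i with _ | i
    · show 0 < (-1) ^ (0 + 1) * (y * (auxM B s d y).det)
      have h2 := mul_pos (neg_pos.2 hy0) hyp
      have h3 : (-1 : ℝ) ^ (0 + 1) * (y * (auxM B s d y).det) = -y * (auxM B s d y).det := by ring
      rw [h3]; exact h2
    · show 0 < (-1) ^ (i + 1 + 1) * (x (i + 1) * (auxM B s d (x (i + 1))).det)
      have h1 := hs (i + 1) hi
      have h2 := mul_pos (neg_pos.2 (hneg i hi)) h1
      have h3 : (-1 : ℝ) ^ (i + 1 + 1) * (x (i + 1) * (auxM B s d (x (i + 1))).det) =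
          -x (i + 1) * ((-1) ^ (i + 1) * (auxM B s d (x (i + 1))).det) := by ring
      rw [h3]; exact h2
  have hcard : (insert j s).card = s.card + 1 := Finset.card_insert_of_notMem hj
  have hε : ∀ᶠ e in 𝓝[>] (0:ℝ), ∀ i ∈ Finset.range (s.card + 1),
      0 < (-1) ^ (i + 1) * (z (i + 1) * (auxM B s d (z (i + 1))).det
        + e * -((auxM B s d (z (i + 1))).updateCol j (fun i => B i j)).det) := by
    apply Filter.Eventually.filter_mono nhdsWithin_le_nhds
    rw [Filter.eventually_all_finset]
    intro i hi
    have hc : Continuous fun e : ℝ => (-1) ^ (i + 1) * (z (i + 1) * (auxM B s d (z (i + 1))).det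
        + e * -((auxM B s d (z (i + 1))).updateCol j (fun i => B i j)).det) := by fun_prop
    refine hc.continuousAt.eventually (lt_mem_nhds ?_)
    simpa using hz i (by simpa [Nat.lt_succ_iff] using hi)
  obtain ⟨e, he, he0⟩ := (hε.and self_mem_nhdsWithin).exists
  have he0 : 0 < e := he0
  have hd' : ∀ i, 0 < Function.update d j e i := by
    intro i
    by_cases hi : i = j
    · subst hi; simpa using he0
    · simpa [hi] using hd i
  refine ⟨Function.update d j e, hd', z, rfl, ?_, ?_⟩
  · intro i hi
    rw [hcard] at hi
    rcases i with _ | _ | i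
    · exact hy0
    · exact hyx (by omega)
    · exact hx (i + 1) (by omega)
  · intro i hi
    rw [hcard] at hi
    rcases i with _ | i
    · show 0 < (-1) ^ 0 * (auxM B (insert j s) (Function.update d j e) 0).det
      rw [auxM_zero, pow_zero, one_mul]
      exact mul_pos hdet (Finset.prod_pos fun i _ => hd' i)
    · rw [auxM_insert _ _ _ _ hj]
      exact he i (by simpa using hi)

theorem good_univ (B : Matrix m m ℝ) (hff : IsPMinusFF B) : Good B Finset.univ := by
  obtain ⟨hP, κ, hc, hmono, hdet⟩ := hff
  have key : ∀ k, ∀ hk : k < Fintype.card m, Good B (κ ⟨k, hk⟩) := by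
    intro k
    induction k with
    | zero =>
      intro hk
      have h1 := hc ⟨0, hk⟩
      obtain ⟨j, hj⟩ := Finset.card_eq_one.1 h1
      have h2 := hP _ (hdet ⟨0, hk⟩)
      rw [hj] at h2 ⊢
      exact good_insert B ∅ j (by simp) h2 (good_empty B)
    | succ k ih =>
      intro hk
      have hk' : k < Fintype.card m := by omega
      have h0 := ih hk'
      have hsub := hmono ⟨k, hk'⟩ ⟨k + 1, hk⟩ (by simp)
      have c1 := hc ⟨k, hk'⟩
      have c2 := hc ⟨k + 1, hk⟩
      have h2 := hP _ (hdet ⟨k + 1, hk⟩)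
      obtain ⟨j, hj, hins⟩ : ∃ j, j ∉ κ ⟨k, hk'⟩ ∧ insert j (κ ⟨k, hk'⟩) = κ ⟨k + 1, hk⟩ := by
        have hcs : (κ ⟨k + 1, hk⟩ \ κ ⟨k, hk'⟩).card = 1 := by
          rw [Finset.card_sdiff_of_subset hsub, c1, c2]; simp
        obtain ⟨j, hj⟩ := Finset.card_eq_one.1 hcs
        have hjm : j ∈ κ ⟨k + 1, hk⟩ \ κ ⟨k, hk'⟩ := by rw [hj]; simp
        refine ⟨j, (Finset.mem_sdiff.1 hjm).2, ?_⟩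
        rw [Finset.insert_eq, ← hj, Finset.sdiff_union_of_subset hsub]
      rw [← hins] at h2 ⊢
      exact good_insert B _ j hj h2 h0
  rcases Nat.eq_zero_or_pos (Fintype.card m) with h | h
  · have : (Finset.univ : Finset m) = ∅ := by
      rw [← Finset.card_eq_zero, Finset.card_univ, h]
    rw [this]; exact good_empty B
  · have h1 := key (Fintype.card m - 1) (by omega)
    have h2 := hc ⟨Fintype.card m - 1, by omega⟩
    have : κ ⟨Fintype.card m - 1, by omega⟩ = Finset.univ := by
      rw [← Finset.card_eq_iff_eq_univ, h2]
      simp; omega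
    rwa [this] at h1

theorem stable_of_good (B : Matrix m m ℝ) (h : Good B Finset.univ) :
    ∃ d : m → ℝ, (∀ i, 0 < d i) ∧ HurwitzStable (B * Matrix.diagonal d) := by
  obtain ⟨d, hd, x, hx0, hx, hs⟩ := h
  refine ⟨d, hd, ?_⟩
  rw [Finset.card_univ] at hx hs
  have hev : ∀ y, (B * Matrix.diagonal d).charpoly.eval y = (auxM B Finset.univ d y).det := by
    intro y
    rw [Matrix.eval_charpoly]
    congr 1
    ext i j
    rw [Matrix.sub_apply, Matrix.mul_diagonal]
    simp [auxM, Matrix.scalar_apply, Matrix.diagonal_apply]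
    ring
  have hroot : ∀ i : Fin (Fintype.card m), ∃ r, x (i + 1) < r ∧ r < x i ∧
      (auxM B Finset.univ d r).det = 0 := by
    intro i
    have hlt := hx i i.2
    have h1 := hs i i.2.le
    have h2 := hs (i + 1) i.2
    have hc : ContinuousOn (fun y => (-1) ^ (i:ℕ) * (auxM B Finset.univ d y).det)
        (Set.Icc (x (i + 1)) (x i)) := (continuous_const.mul (auxM_cont B _ d)).continuousOn
    obtain ⟨r, hr, hr0⟩ := intermediate_value_Ioo hlt.le hc
      (show (0:ℝ) ∈ Set.Ioo _ _ from ⟨by rw [pow_succ] at h2; linarith, h1⟩)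
    refine ⟨r, hr.1, hr.2, ?_⟩
    simpa using hr0
  choose r hr1 hr2 hr0 using hroot
  have hanti : ∀ i j : ℕ, i ≤ j → j ≤ Fintype.card m → x j ≤ x i := by
    intro i j hij
    induction j, hij using Nat.le_induction with
    | base => intro _; exact le_rfl
    | succ j hij ih => intro hj; exact (hx j hj).le.trans (ih (by omega))
  have hrneg : ∀ i, r i < 0 := fun i => by
    have := hanti 0 i (Nat.zero_le _) i.2.le
    rw [hx0] at this
    exact (hr2 i).trans_le this
  have hrlt : ∀ i j, i < j → r j < r i := fun i j hij =>
    ((hr2 j).trans_le (hanti (i + 1) j hij j.2.le)).trans (hr1 i)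
  have hrinj : Function.Injective r := (show StrictAnti r from fun i j hij => hrlt i j hij).injective
  have hinj : Function.Injective (fun i => (r i : ℂ)) := Complex.ofReal_injective.comp hrinj
  let S : Finset ℂ := Finset.univ.map ⟨_, hinj⟩
  have hmap : ((B * Matrix.diagonal d).map Complex.ofReal).charpoly =
      (B * Matrix.diagonal d).charpoly.map Complex.ofRealHom :=
    Matrix.charpoly_map _ Complex.ofRealHom
  have hle : S.val ≤ spec (B * Matrix.diagonal d) := by
    rw [Multiset.le_iff_subset S.nodup]
    intro w hw
    obtain ⟨i, -, rfl⟩ := Finset.mem_map.1 (show _ ∈ S from hw)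
    unfold spec
    rw [Polynomial.mem_roots (Matrix.charpoly_monic _).ne_zero, Polynomial.IsRoot, hmap]
    show Polynomial.eval (Complex.ofRealHom (r i)) _ = 0
    rw [Polynomial.eval_map_apply, hev, hr0]
    simp
  have heq : S.val = spec (B * Matrix.diagonal d) := by
    apply Multiset.eq_of_le_of_card_le hle
    refine (Polynomial.card_roots' _).trans ?_
    rw [Matrix.charpoly_natDegree_eq_dim]
    simp [S]
  intro w hw
  rw [← heq] at hw
  obtain ⟨i, -, rfl⟩ := Finset.mem_map.1 (show _ ∈ S from hw)
  exact hrneg i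

end helpers

/-- Let `A` be a real `n×n` matrix having a principal submatrix `A[κ]` that
is Hurwitz-unstable and is a `P⁻_FF` (Fisher–Fuller) matrix. Then `A` is D-Hopf. -/
theorem isDHopf_of_unstable_pminusFF {n : ℕ} (A : Matrix (Fin n) (Fin n) ℝ)
    (κ : Finset (Fin n)) (hu : HurwitzUnstable (psub A κ))
    (hff : IsPMinusFF (psub A κ)) : IsDHopf A := by
  obtain ⟨d, hd, hst⟩ := stable_of_good _ (good_univ _ hff)
  have hdet : (psub A κ).det ≠ 0 := by
    intro h0
    obtain ⟨-, τ, hc, -, hτ⟩ := hff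
    have hpos : 0 < Fintype.card κ := by
      by_contra hcon
      have : Fintype.card κ = 0 := by omega
      have : IsEmpty κ := Fintype.card_eq_zero_iff.1 this
      rw [Matrix.det_isEmpty] at h0
      exact one_ne_zero h0
    have h2 := hc ⟨Fintype.card κ - 1, by omega⟩
    have h3 : τ ⟨Fintype.card κ - 1, by omega⟩ = Finset.univ := by
      rw [← Finset.card_eq_iff_eq_univ, h2]
      simp only; omega
    have h4 := hτ ⟨Fintype.card κ - 1, by omega⟩
    rw [h3] at h4
    have h5 := auxM_zero (psub A κ) Finset.univ (fun _ => 1)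
    have h6 : auxM (psub A κ) Finset.univ (fun _ => 1) 0 = - psub A κ := by
      ext i j; simp [auxM]
    rw [h6, Matrix.det_neg, h0] at h5
    have h7 : (0 : ℝ) ≠ (-1) ^ (Finset.univ : Finset κ).card *
        (psub (psub A κ) Finset.univ).det * ∏ j : κ, (1 : ℝ) := by
      rw [Finset.prod_const_one, mul_one]
      exact (mul_ne_zero (pow_ne_zero _ (by norm_num)) h4).symm
    rw [mul_zero] at h5
    exact h7 h5
  refine ⟨κ, hdet, fun _ => 1, d, fun _ => one_pos, hd, ?_⟩
  intro h
  have h1 : psub A κ * Matrix.diagonal (fun _ => (1:ℝ)) = psub A κ := by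
    rw [Matrix.diagonal_one, mul_one]
  rw [h1] at h
  have h2 := congrArg (fun t => t.2.1) h
  simp only [inertia] at h2
  have h3 : Multiset.card ((spec (psub A κ * Matrix.diagonal d)).filter fun z => 0 < z.re) = 0 := by
    rw [Multiset.card_eq_zero, Multiset.filter_eq_nil]
    intro z hz
    exact not_lt.2 (hst z hz).le
  obtain ⟨z, hz, hzp⟩ := hu
  have h4 : 0 < Multiset.card ((spec (psub A κ)).filter fun z => 0 < z.re) := 
    Multiset.card_pos_iff_exists_mem.2 ⟨z, Multiset.mem_filter.2 ⟨hz, hzp⟩⟩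
  have h5 : Multiset.card ((spec (psub A κ)).filter fun z => 0 < z.re) = 0 := by
    rw [← h3]; convert h2
  omega
end

section
/- Let A be a real n×n matrix having a k×k principal submatrix A[κ] that is invertible, Hurwitz-unstable, a P⁻₀ matrix, and has a Hurwitz-stable (k−1)×(k−1) principal submatrix. Then A is D-Hopf. -/
open Matrix

lemma key_aux {m : Type*} [Fintype m] [DecidableEq m] (B : Matrix m m ℝ) (j : m)
    (h0 : 0 < (-B).det) (q0 : 0 < (updateCol (-B) j (Pi.single j 1)).det)
    (hq : ∀ z : ℂ, 0 ≤ z.re →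
      (updateCol (Matrix.scalar m z - B.map Complex.ofReal) j (Pi.single j 1)).det ≠ 0) :
    ∃ d : m → ℝ, (∀ i, 0 < d i) ∧ HurwitzStable (B * Matrix.diagonal d) := by
  set M : ℂ → Matrix m m ℂ := fun z => Matrix.scalar m z - B.map Complex.ofReal with hM
  set q : ℂ → ℂ := fun z => (updateCol (M z) j (Pi.single j 1)).det with hqdef
  set r : ℂ → ℂ := fun z => (updateCol (M z) j (fun i => -(B i j : ℂ))).det with hrdef
  have hMc : Continuous M := by
    apply continuous_matrix
    intro a b
    simp only [hM, Matrix.sub_apply, Matrix.scalar_apply, Matrix.diagonal_apply]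
    split_ifs <;> fun_prop
  have hqc : Continuous q := (hMc.matrix_updateCol j continuous_const).matrix_det
  have hrc : Continuous r := (hMc.matrix_updateCol j continuous_const).matrix_det
  have hM0 : M 0 = (-B).map Complex.ofRealHom := by
    ext a b; simp [hM]
  have hr0 : r 0 = (((-B).det : ℝ) : ℂ) := by
    have : updateCol (M 0) j (fun i => -(B i j : ℂ)) = (-B).map Complex.ofRealHom := by
      rw [hM0]; ext a b
      by_cases hb : b = j
      · subst hb; simp
      · simp [hb]
    simp only [hrdef]
    rw [this]
    exact (RingHom.map_det Complex.ofRealHom (-B)).symm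
  have hq0 : q 0 = (((updateCol (-B) j (Pi.single j 1)).det : ℝ) : ℂ) := by
    have : updateCol (M 0) j (Pi.single j 1) =
        (updateCol (-B) j (Pi.single j 1)).map Complex.ofRealHom := by
      rw [hM0]; ext a b
      by_cases hb : b = j
      · subst hb
        by_cases ha : a = b
        · subst ha; simp
        · simp [ha]
      · simp [hb]
    simp only [hqdef]
    rw [this]
    exact (RingHom.map_det Complex.ofRealHom _).symm
  -- determinant identity
  have hid : ∀ (e : ℝ) (z : ℂ),
      (Matrix.scalar m z - (B * Matrix.diagonal (Function.update (1 : m → ℝ) j e)).map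
        Complex.ofReal).det = z * q z + e * r z := by
    intro e z
    have : Matrix.scalar m z - (B * Matrix.diagonal (Function.update (1 : m → ℝ) j e)).map
        Complex.ofReal = updateCol (M z) j
          (z • (Pi.single j 1 : m → ℂ) + (e : ℂ) • (fun i => -(B i j : ℂ))) := by
      ext a b
      by_cases hb : b = j
      · subst hb
        by_cases ha : a = b
        · subst ha; simp [Matrix.mul_diagonal]; ring
        · simp [ha, Matrix.mul_diagonal]; ring
      · simp [hb, Matrix.mul_diagonal, hM]
    rw [this, det_updateCol_add, det_updateCol_smul, det_updateCol_smul]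
  -- bound
  obtain ⟨R, hR⟩ : ∃ R : ℝ, ∀ (e : ℝ), 0 < e → e ≤ 1 → ∀ z ∈ spec (B * Matrix.diagonal
      (Function.update (1 : m → ℝ) j e)), ‖z‖ ≤ R := by
    refine ⟨∑ a, ∑ b, ‖(B a b : ℂ)‖, ?_⟩
    intro e he he1 z hz
    unfold spec at hz
    rw [Polynomial.mem_roots (Matrix.charpoly_monic _).ne_zero, Polynomial.IsRoot.def,
      Matrix.eval_charpoly] at hz
    obtain ⟨v, hv, hv0⟩ := Matrix.exists_mulVec_eq_zero_iff.mpr hz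
    have hv' : ∀ a, z * v a = ∑ b, (B a b * (Function.update (1 : m → ℝ) j e b : ℝ) : ℂ) * v b := by
      intro a
      have := congrFun hv0 a
      rw [Matrix.sub_mulVec, Pi.sub_apply, Pi.zero_apply, sub_eq_zero] at this
      simpa [Matrix.mulVec, dotProduct, Matrix.mul_diagonal, Matrix.diagonal_apply] using this
    have hne : Nonempty m := ⟨j⟩
    obtain ⟨a, ha⟩ := Finite.exists_max (fun a => ‖v a‖)
    have hapos : 0 < ‖v a‖ := by
      by_contra hcon
      apply hv
      ext b
      have := ha b
      have h2 : ‖v b‖ ≤ 0 := by linarith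
      simpa using h2
    have h1 : ‖z‖ * ‖v a‖ ≤ (∑ b, ‖(B a b : ℂ)‖) * ‖v a‖ := by
      rw [← norm_mul, hv' a, Finset.sum_mul]
      refine (norm_sum_le _ _).trans (Finset.sum_le_sum fun b _ => ?_)
      rw [norm_mul, norm_mul]
      have : ‖((Function.update (1 : m → ℝ) j e b : ℝ) : ℂ)‖ ≤ 1 := by
        by_cases hb : b = j
        · subst hb; simp [abs_of_pos he, he1]
        · simp [hb]
      calc ‖(B a b : ℂ)‖ * ‖((Function.update (1 : m → ℝ) j e b : ℝ) : ℂ)‖ * ‖v b‖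
          ≤ ‖(B a b : ℂ)‖ * 1 * ‖v a‖ := by gcongr; exact ha b
        _ = _ := by ring
    have h2 := le_of_mul_le_mul_right h1 hapos
    refine h2.trans ?_
    exact Finset.single_le_sum (f := fun a => ∑ b, ‖(B a b : ℂ)‖)
      (fun a _ => Finset.sum_nonneg fun b _ => norm_nonneg _) (Finset.mem_univ a)
  set S : Set ℂ := Metric.closedBall 0 R ∩ {z | 0 ≤ z.re} with hS
  have hScomp : IsCompact S :=
    (isCompact_closedBall 0 R).inter_right (isClosed_le continuous_const Complex.continuous_re)
  have hcont : ContinuousOn (fun z => r z / q z) S :=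
    hrc.continuousOn.div hqc.continuousOn (fun z hz => hq z hz.2)
  obtain ⟨C, hC⟩ := hScomp.exists_bound_of_continuousOn hcont
  have hq0ne : q 0 ≠ 0 := hq 0 (by simp)
  have hcat : ContinuousAt (fun z => (r z / q z).re) 0 :=
    Complex.continuous_re.continuousAt.comp (hrc.continuousAt.div hqc.continuousAt hq0ne)
  have hpos0 : 0 < (r 0 / q 0).re := by
    rw [hr0, hq0, ← Complex.ofReal_div, Complex.ofReal_re]
    exact div_pos h0 q0
  obtain ⟨δ, hδ, hball⟩ := Metric.eventually_nhds_iff.mp (hcat.eventually (lt_mem_nhds hpos0))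
  set e : ℝ := min 1 (δ / (|C| + 1)) / 2 with he
  have hepos : 0 < e := by positivity
  have he1 : e ≤ 1 := by
    have := min_le_left 1 (δ / (|C| + 1)); linarith
  have heδ : e * (|C| + 1) < δ := by
    have h1 : min 1 (δ / (|C| + 1)) ≤ δ / (|C| + 1) := min_le_right _ _
    have h2 : 0 < δ / (|C| + 1) := by positivity
    have : e < δ / (|C| + 1) := by linarith
    exact (lt_div_iff₀ (by positivity)).mp this
  refine ⟨Function.update 1 j e, ?_, ?_⟩
  · intro i
    by_cases hi : i = j
    · subst hi; simpa using hepos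
    · simp [hi]
  · intro z hz
    by_contra hre
    push Not at hre
    have hzR := hR e hepos he1 z hz
    have hzS : z ∈ S := ⟨by simpa using hzR, hre⟩
    unfold spec at hz
    rw [Polynomial.mem_roots (Matrix.charpoly_monic _).ne_zero, Polynomial.IsRoot.def,
      Matrix.eval_charpoly, hid] at hz
    have hqz : q z ≠ 0 := hq z hre
    have hzeq : z = -(e * (r z / q z)) := by
      field_simp
      linear_combination hz
    have hn : ‖z‖ < δ := by
      have h1 : ‖z‖ = e * ‖r z / q z‖ := by
        conv_lhs => rw [hzeq]
        rw [norm_neg, norm_mul, Complex.norm_real, Real.norm_of_nonneg hepos.le]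
      rw [h1]
      refine lt_of_le_of_lt ?_ heδ
      have := hC z hzS
      have h3 := le_abs_self C
      exact mul_le_mul_of_nonneg_left (by linarith) hepos.le
    have h5 := hball (y := z) (by simpa using hn)
    have h6 : z.re = -(e * (r z / q z).re) := by
      conv_lhs => rw [hzeq]
      rw [Complex.neg_re, Complex.re_ofReal_mul]
    have := mul_pos hepos h5
    linarith

lemma det_erase {F : Type*} [Field F] {n : ℕ} (κ : Finset (Fin n)) (j : κ)
    (N : Matrix κ κ F) :
    (updateCol N j (Pi.single j 1)).det =
      (N.submatrix (fun i : (κ.erase j.1 : Finset (Fin n)) => (⟨i.1, Finset.mem_of_mem_erase i.2⟩ : κ))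
        (fun i => ⟨i.1, Finset.mem_of_mem_erase i.2⟩)).det := by
  rw [twoBlockTriangular_det' _ (fun i => i ≠ j)]
  · have h2 : (toSquareBlockProp (updateCol N j (Pi.single j 1)) fun i => ¬ (i ≠ j)).det = 1 := by
      have : (toSquareBlockProp (updateCol N j (Pi.single j 1)) fun i => ¬ (i ≠ j)) = 1 := by
        ext ⟨a, ha⟩ ⟨b, hb⟩
        push Not at ha hb
        subst ha; subst hb
        simp [toSquareBlockProp]
      rw [this, det_one]
    rw [h2, mul_one]
    let e : (κ.erase j.1 : Finset (Fin n)) ≃ {i : κ // i ≠ j} :=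
      { toFun := fun i => ⟨⟨i.1, Finset.mem_of_mem_erase i.2⟩, fun h =>
          (Finset.ne_of_mem_erase i.2) (congrArg Subtype.val h)⟩
        invFun := fun i => ⟨i.1.1, Finset.mem_erase.mpr ⟨fun h => i.2 (Subtype.ext h), i.1.2⟩⟩
        left_inv := fun i => rfl
        right_inv := fun i => rfl }
    rw [← Matrix.det_submatrix_equiv_self e]
    congr 1
    ext a b
    have : (e b).1 ≠ j := (e b).2
    change updateCol N j (Pi.single j 1) (e a).1 (e b).1 = N (e a).1 (e b).1
    rw [updateCol_ne this]
  · intro a ha b hb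
    push Not at hb
    subst hb
    simp [ha]

theorem isDHopf_of_unstable_pminuszero_with_stable_sub {n : ℕ}
    (A : Matrix (Fin n) (Fin n) ℝ) (κ : Finset (Fin n))
    (hinv : (psub A κ).det ≠ 0)
    (hu : HurwitzUnstable (psub A κ))
    (hP : IsPMinusZero (psub A κ))
    (hsub : ∃ κ' : Finset (Fin n), κ' ⊆ κ ∧ κ'.card = κ.card - 1 ∧ HurwitzStable (psub A κ')) :
    IsDHopf A := by
  obtain ⟨κ', hκ, hcard, hst⟩ := hsub
  have hne : κ.Nonempty := by
    by_contra hcon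
    rw [Finset.not_nonempty_iff_eq_empty] at hcon
    subst hcon
    obtain ⟨z, hz, -⟩ := hu
    unfold spec at hz
    rw [Matrix.charpoly, Matrix.det_isEmpty] at hz
    simp at hz
  have hkpos := hne.card_pos
  obtain ⟨j, hj⟩ : ∃ j, κ \ κ' = {j} := by
    rw [← Finset.card_eq_one, Finset.card_sdiff_of_subset hκ]; omega
  have hjm : j ∈ κ \ κ' := by rw [hj]; simp
  rw [Finset.mem_sdiff] at hjm
  have hκ' : κ' = κ.erase j := by
    rw [Finset.erase_eq, ← hj, Finset.sdiff_sdiff_eq_self hκ]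
  subst hκ'
  set B := psub A κ with hB
  -- the stable submatrix
  have hq : ∀ z : ℂ, 0 ≤ z.re →
      (updateCol (Matrix.scalar κ z - B.map Complex.ofReal) ⟨j, hjm.1⟩ (Pi.single ⟨j, hjm.1⟩ 1)).det ≠ 0 := by
    intro z hz h
    rw [det_erase κ ⟨j, hjm.1⟩] at h
    have : z ∈ spec (psub A (κ.erase j)) := by
      unfold spec
      rw [Polynomial.mem_roots (Matrix.charpoly_monic _).ne_zero, Polynomial.IsRoot.def,
        Matrix.eval_charpoly]
      refine Eq.trans ?_ h
      congr 1
      ext a b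
      simp only [hB, psub, Matrix.sub_apply, Matrix.scalar_apply, Matrix.diagonal_apply,
        Matrix.map_apply, Matrix.submatrix_apply, Subtype.mk.injEq, Subtype.ext_iff]
    exact absurd (hst z this) (not_lt.mpr hz)
  have h0 : 0 < (-B).det := by
    have hdet : (psub B Finset.univ).det = B.det := by
      have : psub B Finset.univ = B.submatrix (Equiv.subtypeUnivEquiv (fun x => Finset.mem_univ x))
        (Equiv.subtypeUnivEquiv (fun x => Finset.mem_univ x)) := rfl
      rw [this, Matrix.det_submatrix_equiv_self]
    have := hP Finset.univ (by rw [hdet]; exact hinv)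
    rw [hdet] at this
    rw [Matrix.det_neg]
    exact this
  have q0 : 0 < (updateCol (-B) ⟨j, hjm.1⟩ (Pi.single ⟨j, hjm.1⟩ 1)).det := by
    have hcne : (updateCol (-B) ⟨j, hjm.1⟩ (Pi.single ⟨j, hjm.1⟩ 1)).det ≠ 0 := by
      intro h
      apply hq 0 (by simp)
      rw [det_erase κ ⟨j, hjm.1⟩] at h ⊢
      have h' := congrArg Complex.ofRealHom h
      rw [RingHom.map_det, map_zero] at h'
      refine Eq.trans ?_ h'
      congr 1
      ext a b
      simp
    rw [det_erase κ ⟨j, hjm.1⟩] at hcne ⊢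
    rw [Matrix.submatrix_neg, Pi.neg_apply, Pi.neg_apply, Matrix.det_neg] at hcne ⊢
    let T : Finset κ := Finset.univ.erase ⟨j, hjm.1⟩
    let e : (κ.erase j : Finset (Fin n)) ≃ T :=
      { toFun := fun i => ⟨⟨i.1, Finset.mem_of_mem_erase i.2⟩, Finset.mem_erase.mpr ⟨fun h =>
          (Finset.ne_of_mem_erase i.2) (congrArg Subtype.val h), Finset.mem_univ _⟩⟩
        invFun := fun i => ⟨i.1.1, Finset.mem_erase.mpr
          ⟨fun h => (Finset.mem_erase.mp i.2).1 (Subtype.ext h), i.1.2⟩⟩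
        left_inv := fun i => rfl
        right_inv := fun i => rfl }
    have hd : (psub B T).det = (B.submatrix
        (fun i : (κ.erase j : Finset (Fin n)) => (⟨i.1, Finset.mem_of_mem_erase i.2⟩ : κ))
        (fun i => ⟨i.1, Finset.mem_of_mem_erase i.2⟩)).det := by
      rw [← Matrix.det_submatrix_equiv_self e]
      rfl
    have hc : Fintype.card (κ.erase j : Finset (Fin n)) = T.card := by
      rw [Fintype.card_congr e, Fintype.card_coe]
    have := hP T (by rw [hd]; exact right_ne_zero_of_mul hcne)
    rw [hd, ← hc] at this
    exact this
  obtain ⟨d, hd, hstab⟩ := key_aux B ⟨j, hjm.1⟩ h0 q0 hq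
  refine ⟨κ, hinv, d, 1, hd, fun i => one_pos, ?_⟩
  intro heq
  have h2 := congrArg (fun t => t.2.1) heq
  simp only [inertia] at h2
  have hz0 : (Multiset.filter (fun z : ℂ => 0 < z.re) (spec (psub A κ * diagonal d))) = 0 := by
    rw [Multiset.filter_eq_nil]
    intro z hz
    exact not_lt.mpr (hstab z hz).le
  have hone : psub A κ * diagonal (1 : κ → ℝ) = B := by
    rw [show diagonal (1 : κ → ℝ) = 1 from Matrix.diagonal_one, mul_one]
  rw [hone] at h2
  obtain ⟨z, hz, hzp⟩ := hu
  rw [hz0, Multiset.card_zero] at h2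
  have h3 := Multiset.card_eq_zero.mp h2.symm
  rw [Multiset.filter_eq_nil] at h3
  exact h3 z hz hzp
end

section
/- Let Γ be a reaction network with species set M, reaction set E, stoichiometric matrix S and reactant-coefficient matrix s, and let n = dim ker Sᵀ. Then Γ is nondegenerate — i.e. there exists a reactivity matrix R such that S·R has a nonzero (|M|−n)-principal minor — if and only if there exists an invertible (|M|−n)×(|M|−n) CS-matrix of Γ. -/
open Matrix

/-- A reaction network: finite sets `M` of species and `E` of reactions, a nonnegative
reactant-coefficient matrix `s` and a real stoichiometric matrix `S`. -/
structure ReactionNetwork (M E : Type*) [Fintype M] [Fintype E] where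
  /-- stoichiometric matrix -/
  S : Matrix M E ℝ
  /-- reactant coefficients `sʲ_m` -/
  s : E → M → ℝ
  s_nonneg : ∀ j m, 0 ≤ s j m

/-- A reactivity matrix for the network: an `E×M` matrix with `R_{jm} > 0` whenever
`sʲ_m > 0` and `R_{jm} = 0` otherwise. -/
def IsReactivity {M E : Type*} [Fintype M] [Fintype E] (Γ : ReactionNetwork M E)
    (R : Matrix E M ℝ) : Prop :=
  ∀ j m, (0 < Γ.s j m → 0 < R j m) ∧ (Γ.s j m = 0 → R j m = 0)

/-- `n = dim ker Sᵀ`, the number of independent linear conservation laws. -/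
noncomputable def kerDim {M E : Type*} [Fintype M] [Fintype E] [DecidableEq E]
    (Γ : ReactionNetwork M E) : ℕ :=
  Module.finrank ℝ (LinearMap.ker (Matrix.mulVecLin Γ.Sᵀ))

/-- The network is nondegenerate if some reactivity matrix `R` makes `S·R` have a nonzero
`(|M|−n)`-principal minor, where `n = dim ker Sᵀ`. -/
def NondegenerateNetwork {M E : Type*} [Fintype M] [Fintype E] [DecidableEq M] [DecidableEq E]
    (Γ : ReactionNetwork M E) : Prop :=
  ∃ R : Matrix E M ℝ, IsReactivity Γ R ∧
    ∃ κ : Finset M, κ.card = Fintype.card M - kerDim Γ ∧ (psub (Γ.S * R) κ).det ≠ 0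

theorem aux_det_expand {κ E : Type*} [Fintype κ] [DecidableEq κ] [Fintype E] [DecidableEq E]
    (A : Matrix κ E ℝ) (B : Matrix E κ ℝ) :
    (A * B).det = ∑ f : κ → E, (∏ l, B (f l) l) * (Matrix.of fun x l : κ => A x (f l)).det := by
  have h1 : (A * B).det = Matrix.detRowAlternating.toMultilinearMap
      (fun l : κ => ∑ j : E, B j l • (fun x => A x j)) := by
    rw [← Matrix.det_transpose]
    change Matrix.det _ = Matrix.det _
    congr 1
    ext l x
    simp [Matrix.mul_apply, Finset.sum_apply, mul_comm]
  rw [h1, MultilinearMap.map_sum]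
  refine Finset.sum_congr rfl fun f _ => ?_
  rw [MultilinearMap.map_smul_univ, smul_eq_mul]
  congr 1
  rw [← Matrix.det_transpose]
  rfl

/-- A reaction network `Γ` is nondegenerate — i.e. there exists a reactivity
matrix `R` such that `S·R` has a nonzero `(|M|−n)`-principal minor, with `n = dim ker Sᵀ` —
if and only if there exists an invertible `(|M|−n)×(|M|−n)` CS-matrix of `Γ`. -/
theorem nondegenerate_iff_invertible_CS {M E : Type*} [Fintype M] [Fintype E]
    [DecidableEq M] [DecidableEq E] (Γ : ReactionNetwork M E) :
    NondegenerateNetwork Γ ↔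
      ∃ (κ : Finset M) (Eκ : Finset E) (J : κ → Eκ), Function.Bijective J ∧
        κ.card = Fintype.card M - kerDim Γ ∧
        (∀ x : κ, 0 < Γ.s (J x) x) ∧
        (Matrix.of fun x l : κ => Γ.S x (J l)).det ≠ 0 := by
  classical
  constructor
  · rintro ⟨R, hR, κ, hκ, hdet⟩
    have he : psub (Γ.S * R) κ = (Γ.S.submatrix (fun i : κ => (i : M)) id) *
        (R.submatrix id (fun i : κ => (i : M))) := by
      ext i j
      simp [psub, Matrix.mul_apply]
    rw [he, aux_det_expand] at hdet
    obtain ⟨f, -, hf⟩ := Finset.exists_ne_zero_of_sum_ne_zero hdet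
    have hp := left_ne_zero_of_mul hf
    have hd := right_ne_zero_of_mul hf
    have hinj : Function.Injective f := by
      intro a b hab
      by_contra hne
      exact hd (Matrix.det_zero_of_column_eq hne (fun x => by simp [hab]))
    refine ⟨κ, Finset.univ.image f, fun l => ⟨f l, by simp⟩, ⟨?_, ?_⟩, hκ, ?_, hd⟩
    · intro a b hab
      exact hinj (congrArg Subtype.val hab)
    · rintro ⟨y, hy⟩
      obtain ⟨x, -, hx⟩ := Finset.mem_image.1 hy
      exact ⟨x, Subtype.ext hx⟩
    · intro x
      have hx := Finset.prod_ne_zero_iff.1 hp x (Finset.mem_univ _)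
      exact lt_of_le_of_ne (Γ.s_nonneg _ _) fun h0 => hx ((hR _ _).2 h0.symm)
  · rintro ⟨κ, Eκ, J, hJ, hκ, hs, hdet⟩
    let R : ℝ → Matrix E M ℝ := fun ε => Matrix.of fun j m =>
      if Γ.s j m = 0 then 0 else if ∃ h : m ∈ κ, j = (J ⟨m, h⟩ : E) then 1 else ε
    have hc : Continuous fun ε => (psub (Γ.S * R ε) κ).det := by
      refine Continuous.matrix_det ?_
      refine continuous_matrix fun i j => ?_
      simp only [psub, Matrix.submatrix_apply, Matrix.mul_apply]
      refine continuous_finset_sum _ fun k _ => continuous_const.mul ?_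
      simp only [R, Matrix.of_apply]
      split_ifs <;> fun_prop
    have h0 : psub (Γ.S * R 0) κ = Matrix.of fun x l : κ => Γ.S x (J l) := by
      ext i l
      simp only [psub, Matrix.submatrix_apply, Matrix.mul_apply, Matrix.of_apply]
      rw [Finset.sum_eq_single (J l : E)]
      · have := (hs l).ne'
        simp [R, this]
      · intro b _ hb
        simp [R, hb]
      · simp
    have hev : ∀ᶠ ε in nhds (0 : ℝ), (psub (Γ.S * R ε) κ).det ≠ 0 :=
      hc.continuousAt.eventually_ne (by rw [h0]; exact hdet)
    obtain ⟨ε, hε, hpos⟩ := ((hev.filter_mono nhdsWithin_le_nhds).and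
      (self_mem_nhdsWithin : Set.Ioi (0 : ℝ) ∈ nhdsWithin 0 (Set.Ioi 0))).exists
    refine ⟨R ε, fun j m => ⟨fun h => ?_, fun h => ?_⟩, κ, hκ, hε⟩
    · have hpos' : (0 : ℝ) < ε := hpos
      simp only [R, Matrix.of_apply, if_neg h.ne']
      split_ifs <;> first | exact one_pos | exact hpos'
    · simp [R, h]
end

section
/- Let A be a Hurwitz-stable real square matrix that contains as a (necessarily proper) principal submatrix an unstable-positive feedback, i.e. a k'×k' unstable core whose determinant has sign (−1)^{k'−1}. Then A is D-Hopf. -/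
open Matrix

/-- An unstable core is a Hurwitz-unstable square matrix none of whose proper principal
submatrices is Hurwitz-unstable. -/
def IsUnstableCore {m : Type*} [Fintype m] [DecidableEq m] (A : Matrix m m ℝ) : Prop :=
  HurwitzUnstable A ∧ ∀ κ : Finset m, κ ≠ Finset.univ → ¬ HurwitzUnstable (psub A κ)

theorem aux_spec_of_neg {m : Type*} [Fintype m] [DecidableEq m] (M : Matrix m m ℝ) (x : ℝ)
    (hx : 0 < x) (h : (Matrix.scalar m x - M).det < 0) : HurwitzUnstable M := by
  have hev : M.charpoly.eval x < 0 := by rwa [Matrix.eval_charpoly]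
  have hmon := M.charpoly_monic
  have hdeg : 0 < M.charpoly.degree := by
    by_contra hd
    have := Polynomial.Monic.degree_le_zero_iff_eq_one hmon |>.1 (not_lt.1 hd)
    rw [this] at hev
    norm_num at hev
  have ht := Polynomial.tendsto_atTop_of_leadingCoeff_nonneg M.charpoly hdeg
    (by rw [hmon.leadingCoeff]; norm_num)
  obtain ⟨y, hy, hxy⟩ := ((ht.eventually_gt_atTop 0).and (Filter.eventually_ge_atTop x)).exists
  obtain ⟨z, hz, hz0⟩ := intermediate_value_Icc hxy M.charpoly.continuous.continuousOn
    (show (0:ℝ) ∈ _ from ⟨hev.le, hy.le⟩)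
  refine ⟨(z : ℂ), ?_, by simpa using lt_of_lt_of_le hx hz.1⟩
  have hm : (M.map Complex.ofReal).charpoly = M.charpoly.map Complex.ofRealHom :=
    Matrix.charpoly_map M Complex.ofRealHom
  rw [spec, Polynomial.mem_roots (Matrix.charpoly_monic _).ne_zero, hm, Polynomial.IsRoot.def]
  have : (z : ℂ) = Complex.ofRealHom z := rfl
  have hz0 : M.charpoly.eval z = 0 := hz0
  rw [this, Polynomial.eval_map_apply, hz0, map_zero]

theorem aux_spec_univ {m : Type*} [Fintype m] [DecidableEq m] (A : Matrix m m ℝ) :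
    spec (psub A Finset.univ) = spec A := by
  let e : (Finset.univ : Finset m) ≃ m := Equiv.subtypeUnivEquiv (fun i => Finset.mem_univ i)
  have h : (psub A Finset.univ).map Complex.ofReal
      = Matrix.reindex e.symm e.symm (A.map Complex.ofReal) := by
    ext i j; rfl
  rw [spec, h, Matrix.charpoly_reindex, spec]

theorem aux_unstable {m : Type*} [Fintype m] [DecidableEq m] (A : Matrix m m ℝ)
    (κ : Finset m) (h : (-1 : ℝ) ^ κ.card * (psub A κ).det < 0) :
    ∃ d : m → ℝ, (∀ i, 0 < d i) ∧ HurwitzUnstable (A * Matrix.diagonal d) := by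
  have h1 : ∀ᶠ x in nhdsWithin (0:ℝ) (Set.Ioi 0), (psub A κ).charpoly.eval x < 0 := by
    have hc : Filter.Tendsto (fun x => (psub A κ).charpoly.eval x) (nhdsWithin (0:ℝ) (Set.Ioi 0))
        (nhds ((psub A κ).charpoly.eval 0)) :=
      ((psub A κ).charpoly.continuous.tendsto 0).mono_left nhdsWithin_le_nhds
    refine hc.eventually_lt_const ?_
    rw [Matrix.eval_charpoly]
    simpa [Matrix.det_neg] using h
  obtain ⟨x, hx, hx0⟩ := (h1.and self_mem_nhdsWithin).exists
  have hx0 : 0 < x := hx0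
  let d : ℝ → m → ℝ := fun ε i => if i ∈ κ then 1 else ε
  let f : ℝ → ℝ := fun ε => (Matrix.scalar m x - A * Matrix.diagonal (d ε)).det
  have hf : Continuous f := by
    refine Continuous.matrix_det ?_
    refine continuous_const.sub (continuous_const.matrix_mul (Continuous.matrix_diagonal ?_))
    refine continuous_pi fun i => ?_
    by_cases hi : i ∈ κ
    · simpa [d, hi] using continuous_const
    · simpa [d, hi] using continuous_id'
  have hf0 : f 0 < 0 := by
    have hb := Matrix.twoBlockTriangular_det' (Matrix.scalar m x - A * Matrix.diagonal (d 0))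
      (fun i => i ∈ κ) (by
        intro i hi j hj
        have : i ≠ j := by rintro rfl; exact hj hi
        simp [Matrix.mul_diagonal, d, hj, Matrix.diagonal_apply_ne _ this])
    change Matrix.det _ < 0
    rw [hb]
    have e1 : ((Matrix.scalar m x - A * Matrix.diagonal (d 0)).toSquareBlockProp
        (fun i => i ∈ κ)) = Matrix.scalar κ x - psub A κ := by
      ext i j
      have hj : (j : m) ∈ κ := j.2
      by_cases hij : i = j
      · subst hij
        simp [Matrix.toSquareBlockProp_def, psub, d, Matrix.mul_diagonal, hj]
      · have hij' : (i : m) ≠ j := fun h => hij (Subtype.ext h)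
        simp [Matrix.toSquareBlockProp_def, psub, d, Matrix.mul_diagonal,
          Matrix.diagonal_apply_ne _ hij, Matrix.diagonal_apply_ne _ hij', hj]
    have e2 : ((Matrix.scalar m x - A * Matrix.diagonal (d 0)).toSquareBlockProp
        (fun i => ¬ i ∈ κ)) = Matrix.diagonal (fun _ => x) := by
      ext i j
      simp [Matrix.toSquareBlockProp_def, d, Matrix.mul_diagonal, Matrix.diagonal_apply,
        Subtype.ext_iff, j.2]
    rw [e2, Matrix.det_diagonal]
    have e3 := congrArg Matrix.det e1
    rw [← Matrix.eval_charpoly] at e3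
    refine mul_neg_of_neg_of_pos ?_ (Finset.prod_pos fun _ _ => hx0)
    rw [← e3] at hx
    refine lt_of_eq_of_lt ?_ hx
    congr!
  have h2 : ∀ᶠ ε in nhdsWithin (0:ℝ) (Set.Ioi 0), f ε < 0 :=
    ((hf.tendsto 0).mono_left nhdsWithin_le_nhds).eventually_lt_const hf0
  obtain ⟨ε, hε, hε0⟩ := (h2.and self_mem_nhdsWithin).exists
  have hε0 : 0 < ε := hε0
  refine ⟨d ε, fun i => ?_, aux_spec_of_neg _ x hx0 hε⟩
  by_cases hi : i ∈ κ <;> simp [d, hi, hε0]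

/-- Let `A` be a Hurwitz-stable real square matrix containing as a
(necessarily proper) principal submatrix a `k'×k'` unstable-positive feedback, i.e. an
unstable core whose determinant has sign `(−1)^(k'−1)`. Then `A` is D-Hopf. -/
theorem isDHopf_of_stable_with_unstable_positive_feedback {n : ℕ}
    (A : Matrix (Fin n) (Fin n) ℝ) (hs : HurwitzStable A)
    (κ : Finset (Fin n)) (hcore : IsUnstableCore (psub A κ))
    (hsign : 0 < (-1 : ℝ) ^ (κ.card - 1) * (psub A κ).det) :
    IsDHopf A := by
  classical
  have hcard : κ.card ≠ 0 := by
    intro h0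
    obtain rfl := Finset.card_eq_zero.1 h0
    obtain ⟨z, hz, -⟩ := hcore.1
    simp [spec, Matrix.charpoly] at hz
  have hneg : (-1 : ℝ) ^ κ.card * (psub A κ).det < 0 := by
    obtain ⟨k, hk⟩ := Nat.exists_eq_succ_of_ne_zero hcard
    rw [hk] at hsign ⊢
    simp only [Nat.succ_eq_add_one, Nat.add_sub_cancel, pow_succ] at hsign ⊢
    linarith
  obtain ⟨d, hd, z, hz, hzpos⟩ := aux_unstable A κ hneg
  have hs' : HurwitzStable (psub A Finset.univ) := by
    intro w hw
    rw [aux_spec_univ] at hw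
    exact hs w hw
  refine ⟨Finset.univ, ?_, fun _ => 1, fun i => d i, fun _ => one_pos, fun i => hd i, ?_⟩
  · intro hdet
    have h0 : (0 : ℂ) ∈ spec (psub A Finset.univ) := by
      have hm : ((psub A Finset.univ).map Complex.ofReal).charpoly
          = (psub A Finset.univ).charpoly.map Complex.ofRealHom :=
        Matrix.charpoly_map _ Complex.ofRealHom
      rw [spec, Polynomial.mem_roots (Matrix.charpoly_monic _).ne_zero, hm, Polynomial.IsRoot.def,
        ← map_zero Complex.ofRealHom, Polynomial.eval_map_apply, Matrix.eval_charpoly]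
      simp [Matrix.det_neg, hdet]
    simpa using hs' 0 h0
  · intro heq
    have h1 : psub A Finset.univ * Matrix.diagonal (fun _ => (1:ℝ)) = psub A Finset.univ := by
      rw [Matrix.diagonal_one, Matrix.mul_one]
    have h2 : psub A Finset.univ * Matrix.diagonal (fun i : (Finset.univ : Finset (Fin n)) => d i)
        = psub (A * Matrix.diagonal d) Finset.univ := by
      ext i j
      simp [psub, Matrix.mul_diagonal]
    rw [h1, h2] at heq
    have h3 := congrArg (fun t => t.2.1) heq
    simp only [inertia] at h3
    rw [aux_spec_univ (A * Matrix.diagonal d)] at h3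
    rw [Multiset.filter_eq_nil.2 (fun w hw => not_lt.2 (hs' w hw).le), Multiset.card_zero] at h3
    have h4 := Multiset.card_eq_zero.1 h3.symm
    exact Multiset.filter_eq_nil.1 h4 z hz hzpos
end

section
/- Every unstable-negative feedback is a Hurwitz-unstable P⁻₀ matrix. That is, if a k×k real matrix A is Hurwitz-unstable, no proper principal submatrix of A is Hurwitz-unstable, and sign(det A) = (−1)ᵏ, then every nonzero k'-principal minor of A has sign (−1)^{k'}. -/
open Matrix

theorem det_sign_of_not_unstable {m : Type*} [Fintype m] [DecidableEq m] (B : Matrix m m ℝ)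
    (h : ¬ HurwitzUnstable B) (hd : B.det ≠ 0) :
    0 < (-1 : ℝ) ^ (Fintype.card m) * B.det := by
  have h0 : (-1 : ℝ) ^ (Fintype.card m) * B.det = B.charpoly.eval 0 := by
    rw [Matrix.det_eq_sign_charpoly_coeff, ← mul_assoc, ← mul_pow,
      Polynomial.coeff_zero_eq_eval_zero]
    simp
  by_contra hneg
  have hne : (-1 : ℝ) ^ (Fintype.card m) * B.det ≠ 0 :=
    mul_ne_zero (pow_ne_zero _ (by norm_num)) hd
  have hlt : B.charpoly.eval 0 < 0 := by
    rw [← h0]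
    exact lt_of_le_of_ne (not_lt.mp hneg) hne
  have hmon := B.charpoly_monic
  have hdeg : 0 < B.charpoly.degree := by
    by_contra hdg
    have h1 := Polynomial.Monic.degree_le_zero_iff_eq_one hmon |>.mp (not_lt.mp hdg)
    rw [h1] at hlt
    simp at hlt
    linarith
  have ht := B.charpoly.tendsto_atTop_of_leadingCoeff_nonneg hdeg (by rw [hmon]; norm_num)
  obtain ⟨t, ht1, ht0⟩ :=
    ((ht.eventually_gt_atTop 0).and (Filter.eventually_gt_atTop 0)).exists
  obtain ⟨r, hr, hr0⟩ := intermediate_value_Ioo ht0.le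
    (B.charpoly.continuous.continuousOn) (show (0 : ℝ) ∈ _ from ⟨hlt, ht1⟩)
  apply h
  refine ⟨(r : ℂ), ?_, by simpa using hr.1⟩
  have hc : (B.map Complex.ofReal).charpoly = B.charpoly.map Complex.ofRealHom :=
    Matrix.charpoly_map B Complex.ofRealHom
  unfold spec
  rw [hc, Polynomial.mem_roots (hmon.map _).ne_zero, Polynomial.IsRoot.def]
  have := Polynomial.eval_map_apply (f := Complex.ofRealHom) (p := B.charpoly) r
  simp only [Complex.ofRealHom_eq_coe] at this
  rw [this]
  simpa using hr0

/-- Every unstable-negative feedback is a Hurwitz-unstable `P⁻₀` matrix: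
if a `k×k` real matrix `A` is Hurwitz-unstable, no proper principal submatrix of `A` is
Hurwitz-unstable, and `sign (det A) = (−1)ᵏ`, then every nonzero `k'`-principal minor of `A`
has sign `(−1)^(k')`. -/
theorem pminuszero_of_unstable_negative_feedback {n : ℕ} (A : Matrix (Fin n) (Fin n) ℝ)
    (hu : HurwitzUnstable A)
    (hmin : ∀ κ : Finset (Fin n), κ ≠ Finset.univ → ¬ HurwitzUnstable (psub A κ))
    (hsign : 0 < (-1 : ℝ) ^ n * A.det) :
    IsPMinusZero A := by
  intro κ hκ
  by_cases hk : κ = Finset.univ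
  · subst hk
    have : (psub A Finset.univ).det = A.det := by
      let e : {x // x ∈ (Finset.univ : Finset (Fin n))} ≃ Fin n :=
        Equiv.subtypeUnivEquiv (fun x => Finset.mem_univ x)
      have h1 : psub A Finset.univ = A.submatrix e e := by
        ext i j
        rfl
      rw [h1]
      exact Matrix.det_submatrix_equiv_self e A
    rw [this]
    simpa using hsign
  · have := det_sign_of_not_unstable _ (hmin κ hk) hκ
    simpa using this
end

section
/- Let A be a k×k unstable-negative feedback (a Hurwitz-unstable matrix with no Hurwitz-unstable proper principal submatrix and determinant of sign (−1)ᵏ) that is moreover a P⁻_FF (Fisher–Fuller) matrix. Then A is D-Hopf. -/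
open Matrix

lemma aux_det_supp {n : ℕ} (A : Matrix (Fin n) (Fin n) ℝ) (S : Finset (Fin n)) (d : Fin n → ℝ)
    (hd : ∀ i, i ∉ S → d i = 0) (y : ℝ) :
    (Matrix.scalar (Fin n) y - A * diagonal d).det =
      (Matrix.scalar S y - psub A S * diagonal (fun i : S => d i)).det * y ^ (n - S.card) := by
  rw [Matrix.twoBlockTriangular_det' _ (fun i => i ∈ S)]
  · have h1 : (toSquareBlockProp (Matrix.scalar (Fin n) y - A * diagonal d) (fun i => i ∈ S))
          = (Matrix.scalar S y - psub A S * diagonal (fun i : S => d i)) := by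
      ext i j
      by_cases h : i = j
      · subst h; simp [toSquareBlockProp, psub, Matrix.mul_diagonal]
      · have h' : (i : Fin n) ≠ j := fun h' => h (Subtype.ext h')
        simp [toSquareBlockProp, psub, Matrix.mul_diagonal, h, h']
    have h2 : (toSquareBlockProp (Matrix.scalar (Fin n) y - A * diagonal d) (fun i => ¬ i ∈ S))
          = diagonal (fun _ => y) := by
      ext i j
      by_cases h : i = j
      · subst h; simp [toSquareBlockProp, Matrix.mul_diagonal, hd i i.2]
      · have h' : (i : Fin n) ≠ j := fun h' => h (Subtype.ext h')
        simp [toSquareBlockProp, Matrix.mul_diagonal, h, h', hd j j.2]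
    rw [h2, det_diagonal, h1]
    congr 1
    · congr!
    · simp [Fintype.card_subtype_compl]
  · intro i hi j hj
    have hne : i ≠ j := by rintro rfl; exact hj hi
    simp [Matrix.mul_diagonal, diagonal_apply, hne, hd j hj]

lemma aux_chain {n : ℕ} (A : Matrix (Fin n) (Fin n) ℝ) (S : ℕ → Finset (Fin n))
    (hcard : ∀ k, k ≤ n → (S k).card = k)
    (hsub : ∀ k, k < n → S k ⊆ S (k + 1))
    (hdet : ∀ k, k ≤ n → 0 < (-1 : ℝ) ^ k * (psub A (S k)).det) (k : ℕ) (hk : k ≤ n) :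
    ∃ (d : Fin n → ℝ) (y : ℕ → ℝ), (∀ i ∈ S k, 0 < d i) ∧ (∀ i, i ∉ S k → d i = 0) ∧
      (∀ j, y j < 0) ∧ (∀ j, j < k → y (j + 1) < y j) ∧
      ∀ j ≤ k, 0 < (-1 : ℝ) ^ (n + k + j) *
        (Matrix.scalar (Fin n) (y j) - A * diagonal d).det := by
  induction k with
  | zero =>
    have h0 : S 0 = ∅ := by simpa using hcard 0 hk
    refine ⟨fun _ => 0, fun _ => -1, by simp [h0], by simp, by simp, by simp, ?_⟩
    intro j hj
    obtain rfl : j = 0 := by omega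
    have : (diagonal (fun _ => 0) : Matrix (Fin n) (Fin n) ℝ) = 0 := by simp
    rw [this]
    simp [← mul_pow]
  | succ k ih =>
    obtain ⟨d, y, hpos, hzero, hneg, hdec, hs⟩ := ih (by omega)
    let e : ℝ → Fin n → ℝ := fun ε i => if i ∈ S k then d i else if i ∈ S (k+1) then ε else 0
    have he0 : e 0 = d := by
      ext i
      by_cases h : i ∈ S k
      · simp [e, h]
      · simp [e, h, hzero i h]
    have hec : Continuous e := by
      refine continuous_pi fun i => ?_
      simp only [e]; split_ifs <;> fun_prop
    have hev : ∀ᶠ ε in nhdsWithin (0:ℝ) (Set.Ioi 0), ∀ j ∈ Finset.range (k+1),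
        0 < (-1 : ℝ) ^ (n + k + j) * (Matrix.scalar (Fin n) (y j) - A * diagonal (e ε)).det := by
      rw [Filter.eventually_all_finset]
      intro j hj
      have hc : Continuous fun ε => (-1 : ℝ) ^ (n + k + j) *
          (Matrix.scalar (Fin n) (y j) - A * diagonal (e ε)).det := by
        refine continuous_const.mul (Continuous.matrix_det ?_)
        exact continuous_const.sub (continuous_const.matrix_mul hec.matrix_diagonal)
      refine (hc.tendsto 0).eventually (lt_mem_nhds ?_) |>.filter_mono nhdsWithin_le_nhds
      rw [he0]; exact hs j (by simpa [Nat.lt_succ_iff] using hj)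
    obtain ⟨ε, hε, hεpos⟩ := (hev.and self_mem_nhdsWithin).exists
    have hεpos : 0 < ε := hεpos
    have hez : ∀ i, i ∉ S (k+1) → e ε i = 0 := by
      intro i hi
      have : i ∉ S k := fun h => hi (hsub k (by omega) h)
      simp [e, hi, this]
    have hep : ∀ i ∈ S (k+1), 0 < e ε i := by
      intro i hi
      simp only [e, hi, if_true]; split_ifs with h
      · exact hpos i h
      · exact hεpos
    -- the new point
    have hev2 : ∀ᶠ t in nhdsWithin (0:ℝ) (Set.Iio 0),
        0 < (Matrix.scalar (S (k+1)) t -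
          psub A (S (k+1)) * diagonal (fun i : S (k+1) => e ε i)).det := by
      have hc : Continuous fun t : ℝ => (Matrix.scalar (S (k+1)) t -
          psub A (S (k+1)) * diagonal (fun i : S (k+1) => e ε i)).det := by
        refine Continuous.matrix_det ?_
        refine Continuous.sub ?_ continuous_const
        exact Continuous.matrix_diagonal (continuous_pi fun _ => continuous_id)
      refine (hc.tendsto 0).eventually (lt_mem_nhds ?_) |>.filter_mono nhdsWithin_le_nhds
      rw [map_zero, zero_sub, det_neg, det_mul, det_diagonal, Fintype.card_coe, hcard _ hk,
        ← mul_assoc]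
      exact mul_pos (hdet _ hk) (Finset.prod_pos fun i _ => hep i i.2)
    have hev3 : ∀ᶠ t in nhdsWithin (0:ℝ) (Set.Iio 0), y 0 < t :=
      (lt_mem_nhds (hneg 0)).filter_mono nhdsWithin_le_nhds
    obtain ⟨t, ⟨ht1, ht2⟩, ht3⟩ := ((hev2.and hev3).and self_mem_nhdsWithin).exists
    have ht3 : t < 0 := ht3
    refine ⟨e ε, fun j => Nat.casesOn j t y, hep, hez, ?_, ?_, ?_⟩
    · rintro (_ | j)
      · exact ht3
      · exact hneg j
    · rintro (_ | j) hj
      · exact ht2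
      · exact hdec j (by omega)
    · rintro (_ | j) hj
      · show 0 < (-1 : ℝ) ^ (n + (k+1) + 0) * (Matrix.scalar (Fin n) t - A * diagonal (e ε)).det
        rw [aux_det_supp A (S (k+1)) (e ε) hez t, hcard _ hk]
        have h1 : (-1 : ℝ) ^ (n + (k+1) + 0) = (-1) ^ (n - (k+1)) := by
          have : n + (k+1) + 0 = (n - (k+1)) + 2 * (k+1) := by omega
          rw [this, pow_add, pow_mul]; simp
        rw [h1, mul_left_comm, ← mul_pow]
        exact mul_pos ht1 (pow_pos (by linarith) _)
      · show 0 < (-1 : ℝ) ^ (n + (k+1) + (j+1)) *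
          (Matrix.scalar (Fin n) (y j) - A * diagonal (e ε)).det
        have h1 : (-1 : ℝ) ^ (n + (k+1) + (j+1)) = (-1) ^ (n + k + j) := by
          have : n + (k+1) + (j+1) = (n + k + j) + 2 := by omega
          rw [this, pow_add]; simp
        rw [h1]
        exact hε j (by simp; omega)

lemma aux_stable {n : ℕ} (M : Matrix (Fin n) (Fin n) ℝ) (y : ℕ → ℝ)
    (hneg : ∀ j, y j < 0) (hdec : ∀ j, j < n → y (j + 1) < y j)
    (hs : ∀ j ≤ n, 0 < (-1 : ℝ) ^ j * (Matrix.scalar (Fin n) (y j) - M).det) :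
    HurwitzStable M := by
  have hr : ∀ j : Fin n, ∃ r, y (j+1) < r ∧ r < y j ∧ M.charpoly.eval r = 0 := by
    intro j
    have h1 := hs j j.2.le
    have h2 := hs (j+1) j.2
    rw [← Matrix.eval_charpoly] at h1 h2
    have hc : ContinuousOn (fun x => (-1:ℝ)^(j:ℕ) * M.charpoly.eval x)
        (Set.Icc (y (j+1)) (y j)) := by fun_prop
    have := intermediate_value_Ioo (hdec j j.2).le hc
    have h0 : (0:ℝ) ∈ Set.Ioo ((-1:ℝ)^(j:ℕ) * M.charpoly.eval (y (j+1)))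
        ((-1:ℝ)^(j:ℕ) * M.charpoly.eval (y j)) := by
      refine ⟨?_, h1⟩
      rw [pow_succ] at h2; linarith
    obtain ⟨r, hr, hr0⟩ := this h0
    refine ⟨r, hr.1, hr.2, ?_⟩
    simpa using hr0
  choose r hr1 hr2 hr3 using hr
  have hanti : ∀ a b : ℕ, a ≤ b → b ≤ n → y b ≤ y a := by
    intro a b hab
    induction b, hab using Nat.le_induction with
    | base => intro _; exact le_rfl
    | succ b _ ih => intro hb; exact (hdec b (by omega)).le.trans (ih (by omega))
  have hlt : ∀ a b : Fin n, a < b → r b < r a := by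
    intro a b hab
    have := hanti (a+1) b (by exact_mod_cast hab) b.2.le
    linarith [hr1 a, hr2 b]
  have hinj : Function.Injective r := by
    intro a b hab
    rcases lt_trichotomy a b with h | h | h
    · exact absurd hab (hlt a b h).ne'
    · exact h
    · exact absurd hab (hlt b a h).ne
  intro z hz
  by_contra hzn
  have hP : (M.map Complex.ofReal).charpoly = M.charpoly.map Complex.ofRealHom :=
    Matrix.charpoly_map M Complex.ofRealHom
  rw [spec, Polynomial.mem_roots (Matrix.charpoly_monic _).ne_zero] at hz
  let s : Finset ℂ := insert z (Finset.univ.image fun j => (r j : ℂ))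
  refine (Matrix.charpoly_monic (M.map Complex.ofReal)).ne_zero
    (Polynomial.eq_zero_of_natDegree_lt_card_of_eval_eq_zero' _ s ?_ ?_)
  · intro w hw
    simp only [s, Finset.mem_insert, Finset.mem_image, Finset.mem_univ, true_and] at hw
    rcases hw with rfl | ⟨j, rfl⟩
    · exact hz
    · rw [hP]
      have := Polynomial.eval_map_apply (p := M.charpoly) Complex.ofRealHom (r j)
      simp only [Complex.ofRealHom_eq_coe] at this
      rw [this, hr3]; simp
  · rw [Matrix.charpoly_natDegree_eq_dim, Fintype.card_fin, Finset.card_insert_of_notMem,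
      Finset.card_image_of_injective _ (fun a b h => hinj (Complex.ofReal_injective h))]
    · simp
    · simp only [Finset.mem_image, Finset.mem_univ, true_and, not_exists]
      rintro j rfl
      apply hzn
      simpa using (hr2 j).trans (hneg j)

lemma aux_spec {m l : Type*} [Fintype m] [DecidableEq m] [Fintype l] [DecidableEq l]
    (e : l ≃ m) (M : Matrix m m ℝ) : spec (M.submatrix e e) = spec M := by
  unfold spec
  have : (M.submatrix e e).map Complex.ofReal
      = Matrix.reindex e.symm e.symm (M.map Complex.ofReal) := by
    ext i j; simp
  rw [this, Matrix.charpoly_reindex]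

/-- Let `A` be a `k×k` unstable-negative feedback (a Hurwitz-unstable
matrix with no Hurwitz-unstable proper principal submatrix and determinant of sign `(−1)ᵏ`)
that is moreover a `P⁻_FF` (Fisher–Fuller) matrix. Then `A` is D-Hopf. -/
theorem isDHopf_of_unstable_negative_feedback_pminusFF {n : ℕ}
    (A : Matrix (Fin n) (Fin n) ℝ)
    (hu : HurwitzUnstable A)
    (hmin : ∀ κ : Finset (Fin n), κ ≠ Finset.univ → ¬ HurwitzUnstable (psub A κ))
    (hsign : 0 < (-1 : ℝ) ^ n * A.det)
    (hff : IsPMinusFF A) :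
    IsDHopf A := by
  classical
  obtain ⟨hP, κ, hc, hsub, hdet⟩ := hff
  let S : ℕ → Finset (Fin n) := fun k =>
    if h : 0 < k ∧ k ≤ n then κ ⟨k - 1, by rw [Fintype.card_fin]; omega⟩ else ∅
  have hS0 : S 0 = ∅ := by simp [S]
  have hS1 : ∀ k (h : k < n), S (k+1) = κ ⟨k, by rw [Fintype.card_fin]; exact h⟩ := by
    intro k h
    have : 0 < k + 1 ∧ k + 1 ≤ n := by omega
    simp only [S, dif_pos this]; rfl
  have hcard : ∀ k, k ≤ n → (S k).card = k := by
    rintro (_ | k) hk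
    · simp [hS0]
    · rw [hS1 k hk, hc]
  obtain ⟨d, y, hpos, -, hneg, hdec, hs⟩ := aux_chain A S hcard
    (by
      rintro (_ | k) hk
      · simp [hS0]
      · rw [hS1 k (by omega), hS1 (k+1) hk]
        exact hsub _ _ (by simp))
    (by
      intro k hk
      have := hP (S k)
      rw [hcard k hk] at this
      apply this
      rcases k with _ | k
      · rw [hS0, Matrix.det_isEmpty]; exact one_ne_zero
      · rw [hS1 k hk]; exact hdet _) n le_rfl
  have hSn : S n = Finset.univ := by
    rw [← Finset.card_eq_iff_eq_univ, hcard n le_rfl, Fintype.card_fin]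
  have hst : HurwitzStable (A * diagonal d) := by
    refine aux_stable _ y hneg hdec fun j hj => ?_
    have := hs j hj
    rwa [pow_add, ← two_mul, pow_mul, neg_one_sq, one_pow, one_mul] at this
  let e : (Finset.univ : Finset (Fin n)) ≃ Fin n := Equiv.subtypeUnivEquiv (by simp)
  have hps : ∀ f : Fin n → ℝ, psub A Finset.univ * diagonal (fun i : (Finset.univ : Finset (Fin n)) => f i)
      = (A * diagonal f).submatrix e e := by
    intro f; ext i j
    simp [psub, Matrix.mul_diagonal, e]
  refine ⟨Finset.univ, ?_, fun i => d i, fun _ => 1, fun i => hpos _ (by simp [hSn]),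
    fun _ => one_pos, ?_⟩
  · have : psub A Finset.univ = A.submatrix e e := rfl
    rw [this, Matrix.det_submatrix_equiv_self]
    rintro h; rw [h] at hsign; simp at hsign
  · intro h
    have h2 := congrArg (fun p => p.2.1) h
    simp only [inertia] at h2
    rw [hps d, hps (fun _ => 1), aux_spec, aux_spec] at h2
    have h3 : (spec (A * diagonal d)).filter (fun z => 0 < z.re) = 0 := by
      rw [Multiset.filter_eq_nil]
      intro z hz; exact (hst z hz).not_gt
    rw [h3, Multiset.card_zero, eq_comm, Multiset.card_eq_zero, Multiset.filter_eq_nil] at h2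
    obtain ⟨z, hz, hz0⟩ := hu
    exact h2 z (by simpa using hz) hz0
end

section
/- Let A be a k×k unstable-negative feedback (a Hurwitz-unstable matrix with no Hurwitz-unstable proper principal submatrix and determinant of sign (−1)ᵏ) such that one of its (k−1)×(k−1) principal submatrices is Hurwitz-stable. Then A is D-Hopf. -/
open Matrix

lemma aux_lower (s : Multiset ℂ) (hs : ∀ z ∈ s, z.re < 0) :
    ∃ c : ℝ, 0 < c ∧ ∀ z : ℂ, 0 ≤ z.re →
      c * (1 + ‖z‖) ^ (Multiset.card s) ≤ ‖(s.map (fun a => z - a)).prod‖ := by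
  induction s using Multiset.induction_on with
  | empty => exact ⟨1, one_pos, by simp⟩
  | cons a s ih =>
    obtain ⟨c, hc, h⟩ := ih (fun z hz => hs z (Multiset.mem_cons_of_mem hz))
    have ha : a.re < 0 := hs a (Multiset.mem_cons_self a s)
    have hK : 0 < 1 + (‖a‖ + 1) / (-a.re) := by
      have : 0 < (‖a‖ + 1) / (-a.re) := div_pos (by positivity) (by linarith)
      linarith
    refine ⟨(1 + (‖a‖ + 1) / (-a.re))⁻¹ * c, by positivity, fun z hz => ?_⟩
    have h1 : 1 + ‖z‖ ≤ (1 + (‖a‖ + 1) / (-a.re)) * ‖z - a‖ := by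
      have e1 : -a.re ≤ ‖z - a‖ := by
        have := Complex.re_le_norm (z - a)
        simp at this
        linarith
      have e2 : ‖z‖ ≤ ‖z - a‖ + ‖a‖ := by
        simpa using norm_add_le (z - a) a
      have e3 : (‖a‖ + 1) ≤ (‖a‖ + 1) / (-a.re) * ‖z - a‖ := by
        rw [div_mul_eq_mul_div, le_div_iff₀ (by linarith)]
        exact mul_le_mul_of_nonneg_left e1 (by positivity)
      linarith
    have h2 : (1 + (‖a‖ + 1) / (-a.re))⁻¹ * (1 + ‖z‖) ≤ ‖z - a‖ := by
      rw [inv_mul_le_iff₀ hK]; exact h1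
    rw [Multiset.map_cons, Multiset.prod_cons, norm_mul, Multiset.card_cons, pow_succ]
    calc _ = ((1 + (‖a‖ + 1) / (-a.re))⁻¹ * (1 + ‖z‖)) * (c * (1 + ‖z‖) ^ (Multiset.card s)) := by
            ring
      _ ≤ _ := mul_le_mul h2 (h z hz) (by positivity) (by positivity)

lemma aux_upper (r : Polynomial ℂ) (N : ℕ) (hr : r.natDegree ≤ N) :
    ∃ C : ℝ, 0 ≤ C ∧ ∀ z : ℂ, ‖r.eval z‖ ≤ C * (1 + ‖z‖) ^ N := by
  refine ⟨∑ i ∈ Finset.range (N + 1), ‖r.coeff i‖, by positivity, fun z => ?_⟩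
  rw [Polynomial.eval_eq_sum_range' (Nat.lt_succ_of_le hr), Finset.sum_mul]
  refine (norm_sum_le _ _).trans (Finset.sum_le_sum fun i hi => ?_)
  rw [norm_mul, norm_pow]
  have hi' : i ≤ N := Nat.lt_succ_iff.mp (Finset.mem_range.mp hi)
  refine mul_le_mul_of_nonneg_left ?_ (norm_nonneg _)
  calc ‖z‖ ^ i ≤ (1 + ‖z‖) ^ i := pow_le_pow_left₀ (norm_nonneg _) (by linarith) _
    _ ≤ _ := pow_le_pow_right₀ (by linarith [norm_nonneg z]) hi'

lemma aux_pert (q r : Polynomial ℂ) (hq : q.Monic) (hs : ∀ z ∈ q.roots, z.re < 0)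
    (hr : r.natDegree ≤ q.natDegree) (a b : ℝ) (ha : 0 < a) (hb : 0 < b)
    (hq0 : q.eval 0 = (a : ℂ)) (hr0 : r.eval 0 = (b : ℂ)) :
    ∃ ε : ℝ, 0 < ε ∧ ∀ z : ℂ, z * q.eval z + (ε : ℂ) * r.eval z = 0 → z.re < 0 := by
  obtain ⟨c, hc, hlow⟩ := aux_lower q.roots hs
  obtain ⟨C, hC, hup⟩ := aux_upper r _ hr
  have hcard : Multiset.card q.roots = q.natDegree :=
    (IsAlgClosed.splits q).natDegree_eq_card_roots.symm
  have hqe : ∀ z, q.eval z = (q.roots.map (fun a => z - a)).prod := fun z => by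
    have := (IsAlgClosed.splits q).eval_eq_prod_roots z
    simpa [hq.leadingCoeff] using this
  have hcont : ContinuousAt (fun z : ℂ => (r.eval z / q.eval z).re) 0 := by
    have : ContinuousAt (fun z : ℂ => r.eval z / q.eval z) 0 :=
      ContinuousAt.div r.continuous.continuousAt q.continuous.continuousAt
        (by rw [hq0]; exact_mod_cast ha.ne')
    exact Complex.continuous_re.continuousAt.comp this
  have hpos : 0 < (r.eval 0 / q.eval 0).re := by
    rw [hq0, hr0, ← Complex.ofReal_div, Complex.ofReal_re]; positivity
  obtain ⟨δ, hδ, hδ'⟩ := Metric.eventually_nhds_iff.mp (hcont.eventually (lt_mem_nhds hpos))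
  refine ⟨δ / (C / c + 1), by positivity, fun z hz => ?_⟩
  set ε := δ / (C / c + 1) with hε
  have hε0 : 0 < ε := by positivity
  by_contra hzre
  push Not at hzre
  have hl := hlow z hzre
  rw [← hqe, hcard] at hl
  have hP : 0 < (1 + ‖z‖) ^ q.natDegree := by positivity
  have hqn : 0 < ‖q.eval z‖ := lt_of_lt_of_le (by positivity) hl
  have hqz : q.eval z ≠ 0 := norm_pos_iff.mp hqn
  have hzz : z = -((ε : ℂ) * (r.eval z / q.eval z)) := by
    field_simp
    linear_combination hz
  have hM : ‖r.eval z / q.eval z‖ ≤ C / c := by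
    rw [norm_div, div_le_div_iff₀ hqn hc]
    calc ‖r.eval z‖ * c ≤ (C * (1 + ‖z‖) ^ q.natDegree) * c :=
          mul_le_mul_of_nonneg_right (hup z) hc.le
      _ = C * (c * (1 + ‖z‖) ^ q.natDegree) := by ring
      _ ≤ _ := mul_le_mul_of_nonneg_left hl hC
  have hzn : ‖z‖ < δ := by
    have h1 : ‖z‖ = ε * ‖r.eval z / q.eval z‖ := by
      conv_lhs => rw [hzz]
      rw [norm_neg, norm_mul, Complex.norm_real, Real.norm_of_nonneg hε0.le]
    have h2 : ε * (C / c + 1) = δ := by rw [hε]; field_simp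
    nlinarith
  have h3 := hδ' (y := z) (by simpa using hzn)
  have h4 : z.re = -(ε * (r.eval z / q.eval z).re) := by
    conv_lhs => rw [hzz]
    rw [Complex.neg_re, Complex.re_ofReal_mul]
  nlinarith [mul_pos hε0 h3]

lemma aux_pos (p : Polynomial ℝ) (hp : p.Monic) (h : ∀ x : ℝ, 0 ≤ x → p.eval x ≠ 0) :
    0 < p.eval 0 := by
  by_cases hd : p.natDegree = 0
  · rw [hp.natDegree_eq_zero.mp hd]; simp
  have ht := p.tendsto_atTop_of_leadingCoeff_nonneg
    (Polynomial.natDegree_pos_iff_degree_pos.mp (Nat.pos_of_ne_zero hd)) (by simp [hp.leadingCoeff])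
  obtain ⟨x, hx, hx0⟩ := ((ht.eventually (Filter.eventually_gt_atTop 0)).and
    (Filter.eventually_ge_atTop (0 : ℝ))).exists
  by_contra hn
  push Not at hn
  obtain ⟨y, hy, hy0⟩ := intermediate_value_Icc hx0 (p.continuous.continuousOn) ⟨hn, hx.le⟩
  exact h y hy.1 hy0

lemma aux_inst {m : Type*} (f1 f2 : Fintype m) (d1 d2 : DecidableEq m) (M N : Matrix m m ℂ)
    (h : M = N) : @Matrix.det m d1 f1 ℂ _ M = @Matrix.det m d2 f2 ℂ _ N := by
  subst h
  have e1 : f1 = f2 := Subsingleton.elim _ _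
  have e2 : d1 = d2 := Subsingleton.elim _ _
  subst e1 e2
  rfl

lemma aux_block {n : ℕ} (M : Matrix (Fin n) (Fin n) ℂ) (κ : Finset (Fin n)) (j : Fin n)
    (hκ : κ = Finset.univ.erase j) (hj : M j j = 1) (h0 : ∀ i, i ≠ j → M i j = 0) :
    M.det = (M.submatrix (fun i : κ => (i : Fin n)) (fun i : κ => (i : Fin n))).det := by
  have hm : ∀ i, i ∈ κ ↔ i ≠ j := fun i => by simp [hκ]
  clear hκ
  have e1 : Matrix.toSquareBlockProp M (fun i => ¬ i ∈ κ) = 1 := by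
    ext x y
    have hx : (x : Fin n) = j := not_not.mp ((not_congr (hm _)).mp x.2)
    have hy : (y : Fin n) = j := not_not.mp ((not_congr (hm _)).mp y.2)
    have : x = y := Subtype.ext (hx.trans hy.symm)
    subst this
    simp [Matrix.toSquareBlockProp, hx, hj]
  have e2 := Matrix.twoBlockTriangular_det' M (fun i => i ∈ κ) (fun i hi k hk => by
    have hk' : k = j := not_not.mp ((not_congr (hm _)).mp hk)
    rw [hk']; exact h0 i ((hm i).mp hi))
  rw [e1, Matrix.det_one, mul_one] at e2
  exact e2.trans (aux_inst _ _ _ _ _ _ rfl)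

lemma aux_det {n : ℕ} (B : Matrix (Fin n) (Fin n) ℂ) (κ : Finset (Fin n)) (j : Fin n)
    (hκ : κ = Finset.univ.erase j) (ε z : ℂ) :
    (B * Matrix.diagonal (Function.update 1 j ε)).charpoly.eval z =
      (1 - ε) * (z * ((B.submatrix (fun i : κ => (i : Fin n)) (fun i : κ => (i : Fin n))).charpoly).eval z)
        + ε * B.charpoly.eval z := by
  simp only [Matrix.eval_charpoly]
  set M := Matrix.scalar (Fin n) z - B with hM
  have h1 : Matrix.scalar (Fin n) z - B * Matrix.diagonal (Function.update 1 j ε) =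
      M.updateCol j (((1 - ε) * z) • (Pi.single j 1 : Fin n → ℂ) + ε • (fun i => M i j)) := by
    ext i k
    by_cases hk : k = j
    · subst hk
      by_cases hik : i = k
      · subst hik; simp [hM]; ring
      · simp [hM, hik]; ring
    · simp [hM, hk]
  have h2 : (M.updateCol j (Pi.single j 1 : Fin n → ℂ)).det =
      (Matrix.scalar κ z - B.submatrix (fun i : κ => (i : Fin n)) (fun i : κ => (i : Fin n))).det := by
    rw [aux_block _ κ j hκ (by simp) (fun i hi => by simp [hi])]
    refine congrArg Matrix.det ?_
    ext x y
    have hy : (y : Fin n) ≠ j := fun h => by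
      have h' : j ∈ κ := h ▸ y.2
      simp [hκ] at h'
    by_cases hxy : x = y
    · subst hxy; simp [hM, hy]
    · have hxy' : (x : Fin n) ≠ y := fun h => hxy (Subtype.ext h)
      simp [hM, hy, hxy, hxy']
  rw [h1, Matrix.det_updateCol_add, Matrix.det_updateCol_smul, Matrix.det_updateCol_smul, h2]
  have h3 : M.updateCol j (fun i => M i j) = M := by
    ext i k; by_cases hk : k = j
    · subst hk; simp
    · simp [hk]
  rw [h3]; ring

lemma aux_spec_s12 {n : ℕ} (A : Matrix (Fin n) (Fin n) ℝ) (d : Fin n → ℝ) :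
    spec (psub A Finset.univ * Matrix.diagonal (fun i : (Finset.univ : Finset (Fin n)) => d i)) =
      spec (A * Matrix.diagonal d) := by
  let e : (Finset.univ : Finset (Fin n)) ≃ Fin n := Equiv.subtypeUnivEquiv (fun x => Finset.mem_univ x)
  have : (psub A Finset.univ * Matrix.diagonal (fun i : (Finset.univ : Finset (Fin n)) => d i)) =
      Matrix.reindex e.symm e.symm (A * Matrix.diagonal d) := by
    ext x y
    simp [psub, e]
  unfold spec
  rw [this]
  have h2 : (Matrix.reindex e.symm e.symm (A * Matrix.diagonal d)).map Complex.ofReal =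
    Matrix.reindex e.symm e.symm ((A * Matrix.diagonal d).map Complex.ofReal) := rfl
  rw [h2, Matrix.charpoly_reindex]

/-- Let `A` be a `k×k` unstable-negative feedback (a Hurwitz-unstable
matrix with no Hurwitz-unstable proper principal submatrix and determinant of sign `(−1)ᵏ`)
such that one of its `(k−1)×(k−1)` principal submatrices is Hurwitz-stable. Then `A` is
D-Hopf. -/
theorem isDHopf_of_unstable_negative_feedback_with_stable_sub {n : ℕ}
    (A : Matrix (Fin n) (Fin n) ℝ)
    (hu : HurwitzUnstable A)
    (hmin : ∀ κ : Finset (Fin n), κ ≠ Finset.univ → ¬ HurwitzUnstable (psub A κ))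
    (hsign : 0 < (-1 : ℝ) ^ n * A.det)
    (hsub : ∃ κ : Finset (Fin n), κ.card = n - 1 ∧ HurwitzStable (psub A κ)) :
    IsDHopf A := by
  classical
  obtain ⟨κ, hcard, hst⟩ := hsub
  have hn : n ≠ 0 := by
    rintro rfl
    obtain ⟨z, hz, _⟩ := hu
    simp [spec] at hz
  obtain ⟨j, hj⟩ : ∃ j, κ = Finset.univ.erase j := by
    have h1 : (κᶜ).card = 1 := by
      rw [Finset.card_compl, hcard, Fintype.card_fin]; omega
    obtain ⟨j, hj⟩ := Finset.card_eq_one.mp h1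
    refine ⟨j, ?_⟩
    rw [← compl_compl κ, hj]
    ext x; simp
  set B : Matrix (Fin n) (Fin n) ℂ := A.map Complex.ofReal with hB
  set q : Polynomial ℂ := ((psub A κ).map Complex.ofReal).charpoly with hq
  have hqm : q.Monic := Matrix.charpoly_monic _
  have hqd : q.natDegree = n - 1 := by
    rw [hq, Matrix.charpoly_natDegree_eq_dim, Fintype.card_coe, hcard]
  have hpm : B.charpoly.Monic := Matrix.charpoly_monic _
  have hpd : B.charpoly.natDegree = n := by
    rw [Matrix.charpoly_natDegree_eq_dim, Fintype.card_fin]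
  set r : Polynomial ℂ := B.charpoly - Polynomial.X * q with hr
  have hXm : (Polynomial.X * q).Monic := Polynomial.monic_X.mul hqm
  have hXd : (Polynomial.X * q).natDegree = n := by
    rw [Polynomial.natDegree_X_mul hqm.ne_zero, hqd]; omega
  have hrd : r.natDegree ≤ q.natDegree := by
    have hlt : r.degree < B.charpoly.degree := by
      apply Polynomial.degree_sub_lt_left
      · rw [Polynomial.degree_eq_natDegree hpm.ne_zero, Polynomial.degree_eq_natDegree hXm.ne_zero,
          hpd, hXd]
      · exact hpm.ne_zero
      · rw [hpm.leadingCoeff, hXm.leadingCoeff]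
    rw [Polynomial.degree_eq_natDegree hpm.ne_zero, hpd] at hlt
    rw [hqd]
    by_cases hr0 : r = 0
    · simp [hr0]
    · have := (Polynomial.natDegree_lt_iff_degree_lt hr0).mpr hlt
      omega
  have hqmap : q = (psub A κ).charpoly.map Complex.ofRealHom := by
    rw [← Matrix.charpoly_map]; rfl
  have hq0 : q.eval 0 = (((psub A κ).charpoly.eval 0 : ℝ) : ℂ) := by
    rw [hqmap]
    simpa using Polynomial.eval_map_apply Complex.ofRealHom (p := (psub A κ).charpoly) (0 : ℝ)
  have ha : 0 < (psub A κ).charpoly.eval 0 := by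
    refine aux_pos _ (Matrix.charpoly_monic _) fun x hx h0 => ?_
    have : (x : ℂ) ∈ spec (psub A κ) := by
      change (x : ℂ) ∈ q.roots
      rw [Polynomial.mem_roots hqm.ne_zero, Polynomial.IsRoot.def, hqmap]
      have := Polynomial.eval_map_apply Complex.ofRealHom (p := (psub A κ).charpoly) x
      rw [h0] at this
      simpa using this
    have := hst _ this
    simp at this
    linarith
  have hr0 : r.eval 0 = (((-1 : ℝ) ^ n * A.det : ℝ) : ℂ) := by
    have hdet : B.det = ((A.det : ℝ) : ℂ) := (RingHom.map_det Complex.ofRealHom A).symm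
    simp [hr, Matrix.eval_charpoly, Matrix.det_neg, hdet]
  obtain ⟨ε, hε, hstab⟩ := aux_pert q r hqm hst hrd _ _ ha hsign hq0 hr0
  let d : Fin n → ℝ := Function.update 1 j ε
  have hd : ∀ i, 0 < d i := fun i => by
    by_cases hi : i = j
    · subst hi; simpa [d] using hε
    · simp [d, hi]
  have hS1 : ∀ z ∈ spec (A * Matrix.diagonal d), z.re < 0 := by
    intro z hz
    apply hstab
    have hmap : (A * Matrix.diagonal d).map Complex.ofReal =
        B * Matrix.diagonal (Function.update 1 j (ε : ℂ)) := by
      ext i k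
      by_cases hk : k = j
      · subst hk; simp [B, d]
      · simp [B, d, hk]
    unfold spec at hz
    rw [hmap] at hz
    have hz' := (Polynomial.mem_roots (Matrix.charpoly_monic _).ne_zero).mp hz
    rw [Polynomial.IsRoot.def, aux_det B κ j hj] at hz'
    change (1 - (ε : ℂ)) * (z * q.eval z) + _ = 0 at hz'
    simp only [hr, Polynomial.eval_sub, Polynomial.eval_mul, Polynomial.eval_X]
    linear_combination hz'
  refine ⟨Finset.univ, ?_, fun i => d i, fun i => (fun _ => 1 : Fin n → ℝ) i, fun i => hd i,
    fun i => one_pos, ?_⟩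
  · have : (psub A Finset.univ).det = A.det := by
      exact Matrix.det_submatrix_equiv_self
        (Equiv.subtypeUnivEquiv (fun x : Fin n => Finset.mem_univ x)) A
    rw [this]
    intro h0
    simp [h0] at hsign
  · intro h
    have h2 := congrArg (fun t => t.2.1) h
    simp only [inertia] at h2
    rw [aux_spec_s12 A d, aux_spec_s12 A (fun _ => 1)] at h2
    have e1 : A * Matrix.diagonal (fun _ => (1 : ℝ)) = A := by
      rw [Matrix.diagonal_one, mul_one]
    rw [e1] at h2
    obtain ⟨z, hz, hzp⟩ := hu
    have h3 : (spec (A * Matrix.diagonal d)).filter (fun z => 0 < z.re) = 0 :=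
      Multiset.filter_eq_nil.mpr fun z hz => not_lt.mpr (hS1 z hz).le
    rw [h3, Multiset.card_zero] at h2
    have h4 := Multiset.card_eq_zero.mp h2.symm
    have h5 : z ∈ (spec A).filter (fun z => 0 < z.re) := Multiset.mem_filter.mpr ⟨hz, hzp⟩
    rw [h4] at h5
    simp at h5
end

section
/- Let n ≥ 0 be an integer, set N = n + 2, and let m > 0 be real. Let A be the N×N real matrix with A_{ii} = −1 for 1 ≤ i ≤ N, A_{i+1,i} = 1 for 1 ≤ i ≤ N−1, A_{1,N} = −m, and all other entries 0. Then the complex eigenvalues of A are exactly the N numbers λ_k = m^{1/N} · e^{(2k+1)πi/N} − 1, for k = 0, 1, …, N−1. -/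
open Matrix

/-- The \`(n+2)×(n+2)\` matrix with \`−1\` on the diagonal, \`1\` on the subdiagonal, and \`−m\`
in the top-right corner: the stoichiometric matrix of the chain
\`X → X₁ → … → X_n → Y\` together with \`mX + Y → …\`. -/
def lengthMatrix (n : ℕ) (m : ℝ) : Matrix (Fin (n + 2)) (Fin (n + 2)) ℝ :=
  Matrix.of fun i j =>
    if (i : ℕ) = (j : ℕ) then -1
    else if (i : ℕ) = (j : ℕ) + 1 then 1
    else if (i : ℕ) = 0 ∧ (j : ℕ) = n + 1 then -m
    else 0

theorem lengthMatrix_root (n : ℕ) (m : ℝ) (w : ℂ) (hw : w ^ (n + 2) = -(m : ℂ)) :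
    (((lengthMatrix n m).map (Complex.ofReal)).charpoly).IsRoot (w - 1) := by
  rw [Polynomial.IsRoot.def, Matrix.eval_charpoly, ← Matrix.exists_mulVec_eq_zero_iff]
  refine ⟨fun i => w ^ (n + 1 - (i : ℕ)), ?_, ?_⟩
  · intro h
    have := congrFun h (Fin.last (n + 1))
    simp at this
  · rw [Matrix.sub_mulVec, sub_eq_zero]
    ext i
    simp only [Matrix.scalar_apply, Matrix.mulVec_diagonal]
    simp only [Matrix.mulVec, dotProduct, Matrix.map_apply]
    induction i using Fin.cases with
    | zero =>
      rw [Finset.sum_eq_add (0 : Fin (n + 2)) (Fin.last (n + 1)) (by simp [Fin.ext_iff])]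
      · simp [lengthMatrix]
        linear_combination hw
      · intro c _ hc
        have h1 : (c : ℕ) ≠ 0 := fun h => hc.1 (Fin.ext (by simpa using h))
        have h2 : (c : ℕ) ≠ n + 1 := fun h => hc.2 (Fin.ext (by simpa using h))
        simp [lengthMatrix, h1.symm, h2]
      · simp
      · simp
    | succ i =>
      rw [Finset.sum_eq_add i.succ i.castSucc (by simp [Fin.ext_iff])]
      · have e : n + 1 - (i : ℕ) = (n + 1 - (i.succ : ℕ)) + 1 := by
          have := i.2
          simp only [Fin.val_succ]; omega
        simp only [lengthMatrix, Fin.val_castSucc, e]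
        simp
        ring
      · intro c _ hc
        have h1 : (i : ℕ) + 1 ≠ c := fun h => hc.1 (Fin.ext (by simpa using h.symm))
        have h2 : (i : ℕ) ≠ c := fun h => hc.2 (Fin.ext (by simpa using h.symm))
        simp [lengthMatrix, h1, h2]
      · simp
      · simp

/-- For `N = n + 2` and real `m > 0`, the complex eigenvalues of the
matrix above are exactly the `N` numbers `λ_k = m^(1/N) · e^((2k+1)πi/N) − 1`,
`k = 0, 1, …, N−1` (as a multiset, i.e. with algebraic multiplicity). -/
theorem spec_lengthMatrix (n : ℕ) (m : ℝ) (hm : 0 < m) :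
    spec (lengthMatrix n m) =
      (Multiset.range (n + 2)).map (fun k =>
        ((m ^ (((n : ℝ) + 2)⁻¹) : ℝ) : ℂ) *
          Complex.exp ((2 * (k : ℂ) + 1) * (Real.pi : ℂ) * Complex.I / ((n : ℂ) + 2)) - 1) := by
  have hN : ((n : ℂ) + 2) ≠ 0 := by exact_mod_cast (Nat.succ_ne_zero (n + 1))
  have hNr : ((n : ℝ) + 2) ≠ 0 := by positivity
  have hlift : (do
      let a ← Multiset.range (n + 2)
      pure (a : ℂ)) = (Multiset.range (n + 2)).map (fun a : ℕ => (a : ℂ)) := by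
    simp only [Multiset.bind_def, Multiset.pure_def, Multiset.bind_singleton]
  rw [hlift, Multiset.map_map]
  simp only [Function.comp_def]
  unfold spec
  symm
  apply Multiset.eq_of_le_of_card_le
  · rw [Multiset.le_iff_subset]
    · intro x hx
      rw [Multiset.mem_map] at hx
      obtain ⟨k, _, rfl⟩ := hx
      rw [Polynomial.mem_roots (Matrix.charpoly_monic _).ne_zero]
      apply lengthMatrix_root
      rw [mul_pow, ← Complex.exp_nat_mul, ← Complex.ofReal_pow, ← Real.rpow_natCast,
        ← Real.rpow_mul hm.le]
      have e1 : ((n : ℝ) + 2)⁻¹ * ((n + 2 : ℕ) : ℝ) = 1 := by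
        push_cast; field_simp
      have e2 : ((n + 2 : ℕ) : ℂ) *
          ((2 * (k : ℂ) + 1) * (Real.pi : ℂ) * Complex.I / ((n : ℂ) + 2))
          = (k : ℂ) * (2 * (Real.pi : ℂ) * Complex.I) + (Real.pi : ℂ) * Complex.I := by
        push_cast; field_simp
      rw [e1, e2, Complex.exp_add, Complex.exp_nat_mul_two_pi_mul_I, Complex.exp_pi_mul_I]
      simp
    · refine Multiset.Nodup.map_on ?_ (Multiset.nodup_range _)
      intro k hk l hl h
      rw [Multiset.mem_range] at hk hl
      have hr : ((m ^ (((n : ℝ) + 2)⁻¹) : ℝ) : ℂ) ≠ 0 :=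
        Complex.ofReal_ne_zero.2 (Real.rpow_pos_of_pos hm _).ne'
      have h := mul_left_cancel₀ hr (sub_left_injective h)
      obtain ⟨j, hj⟩ := Complex.exp_eq_exp_iff_exists_int.1 h
      have hpi : (Real.pi : ℂ) ≠ 0 := Complex.ofReal_ne_zero.2 Real.pi_ne_zero
      have hI := Complex.I_ne_zero
      have h3 : (k : ℂ) = l + j * (n + 2) := by
        have h2 : (2 * (Real.pi : ℂ) * Complex.I) ≠ 0 := by simp [hpi]
        apply mul_left_cancel₀ h2
        field_simp at hj
        linear_combination (Real.pi : ℂ) * Complex.I * hj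
      have h4 : (k : ℤ) = l + j * (n + 2) := by exact_mod_cast h3
      have hj0 : j = 0 := by
        have a : j < 1 := by
          by_contra hc
          have : (n : ℤ) + 2 ≤ j * (n + 2) := by nlinarith
          omega
        have b : -1 < j := by
          by_contra hc
          have : j * (n + 2) ≤ -((n : ℤ) + 2) := by nlinarith
          omega
        omega
      subst hj0
      omega
  · refine (Polynomial.card_roots' _).trans ?_
    rw [Matrix.charpoly_natDegree_eq_dim]
    simp
end

section
/- (Principle of length.) For every real m > 1 there exists N₀ such that for every integer n with n + 2 ≥ N₀, the (n+2)×(n+2) real matrix A with A_{ii} = −1, A_{i+1,i} = 1, A_{1,n+2} = −m and all other entries 0 is Hurwitz-unstable: it has a pair of complex-conjugate eigenvalues with strictly positive real part (e.g. m^{1/(n+2)} e^{±πi/(n+2)} − 1). -/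
open Matrix

theorem mem_spec_aux (n : ℕ) (m : ℝ) (w : ℂ) (hw : w ^ (n + 2) = -(m : ℂ)) :
    w - 1 ∈ spec (lengthMatrix n m) := by
  unfold spec
  rw [Polynomial.mem_roots (Matrix.charpoly_monic _).ne_zero, Polynomial.IsRoot.def,
    Matrix.eval_charpoly, ← Matrix.exists_mulVec_eq_zero_iff]
  refine ⟨fun i => w ^ (n + 1 - (i : ℕ)), ?_, ?_⟩
  · intro h
    have := congrFun h (Fin.last (n + 1))
    simp at this
  · rw [Matrix.sub_mulVec, sub_eq_zero]
    ext i
    simp only [Matrix.scalar_apply, Matrix.mulVec_diagonal]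
    refine Fin.cases ?_ (fun k => ?_) i
    · simp only [Matrix.mulVec, dotProduct, Matrix.map_apply, lengthMatrix, Matrix.of_apply]
      rw [Fin.sum_univ_succ, Fin.sum_univ_castSucc]
      have h0 : ∀ x : Fin n, (x : ℕ) ≠ n := fun x => by omega
      simp [h0]
      linear_combination hw
    · simp only [Matrix.mulVec, dotProduct, Matrix.map_apply, lengthMatrix, Matrix.of_apply]
      have key : ∀ j : Fin (n + 2),
          (((if ((k.succ : Fin (n + 2)) : ℕ) = (j : ℕ) then -1
            else if ((k.succ : Fin (n + 2)) : ℕ) = (j : ℕ) + 1 then 1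
            else if ((k.succ : Fin (n + 2)) : ℕ) = 0 ∧ (j : ℕ) = n + 1 then -m
            else 0 : ℝ)) : ℂ) * w ^ (n + 1 - (j : ℕ)) =
          (if j = k.succ then -w ^ (n + 1 - (j : ℕ)) else 0) +
          (if j = k.castSucc then w ^ (n + 1 - (j : ℕ)) else 0) := by
        intro j
        by_cases h1 : j = k.succ
        · have h2 : j ≠ k.castSucc := by
            rw [h1]; intro h; have := congrArg Fin.val h; simp at this
          simp [h1]
          intro h; have := congrArg Fin.val h; simp at this
        · by_cases h2 : j = k.castSucc
          · subst h2
            simp [h1]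
          · have h1' : (k : ℕ) + 1 ≠ j := fun h => h1 (Fin.ext (by simp [h]))
            have h2' : (k : ℕ) ≠ j := fun h => h2 (Fin.ext (by simp [h]))
            simp [h1, h2, h1', h2']
      rw [Finset.sum_congr rfl (fun j _ => key j), Finset.sum_add_distrib]
      simp only [Finset.sum_ite_eq', Finset.mem_univ, if_true, Fin.val_succ, Fin.val_castSucc]
      have : n + 1 - (k : ℕ) = (n + 1 - ((k : ℕ) + 1)) + 1 := by omega
      rw [this, pow_succ]
      ring

theorem re_aux (L t : ℝ) (hL : 0 < L) (ht : 0 < t) (ht1 : t ≤ 1) (h : 5 * (1 + L) * t < L) :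
    1 < Real.exp (L * t) * Real.cos (Real.pi * t) := by
  have h1 := Real.add_one_le_exp (L * t)
  have h2 := Real.one_sub_sq_div_two_le_cos (x := Real.pi * t)
  have hpi : Real.pi ^ 2 < 10 := by
    nlinarith [Real.pi_lt_d2, Real.pi_pos]
  have h3 : 1 - 5 * t ^ 2 ≤ Real.cos (Real.pi * t) := by
    nlinarith [sq_nonneg t]
  have ht5 : 5 * t < 1 := by nlinarith
  have h4 : 0 < 1 - 5 * t ^ 2 := by nlinarith
  have hLt : 0 < L * t := mul_pos hL ht
  have h5 : 1 < (L * t + 1) * (1 - 5 * t ^ 2) := by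
    have e : (L * t + 1) * (1 - 5 * t ^ 2) - 1 = t * (L - 5 * (1 + L * t) * t) := by ring
    have : 5 * (1 + L * t) * t ≤ 5 * (1 + L) * t := by
      have : L * t ≤ L := by nlinarith
      gcongr
    have := mul_pos ht (show 0 < L - 5 * (1 + L * t) * t by linarith)
    linarith
  calc 1 < (L * t + 1) * (1 - 5 * t ^ 2) := h5
    _ ≤ _ := by gcongr

/-- **Principle of length.** For every real `m > 1` there exists `N₀` such
that for every `n` with `n + 2 ≥ N₀` the matrix above is Hurwitz-unstable: it has a pair of
complex-conjugate (nonreal) eigenvalues with strictly positive real part. -/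
theorem principle_of_length (m : ℝ) (hm : 1 < m) :
    ∃ N₀ : ℕ, ∀ n : ℕ, N₀ ≤ n + 2 →
      HurwitzUnstable (lengthMatrix n m) ∧
      ∃ z ∈ spec (lengthMatrix n m),
        0 < z.re ∧ z.im ≠ 0 ∧ (starRingEnd ℂ) z ∈ spec (lengthMatrix n m) := by
  have hL : 0 < Real.log m := Real.log_pos hm
  obtain ⟨N, hN⟩ := exists_nat_gt (5 * (1 + Real.log m) / Real.log m)
  refine ⟨N, fun n hn => ?_⟩
  set L := Real.log m with hLdef
  set t : ℝ := 1 / ((n : ℝ) + 2) with htdef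
  have hn2 : (0 : ℝ) < (n : ℝ) + 2 := by positivity
  have ht : 0 < t := by positivity
  have ht2 : t * (n + 2) = 1 := by rw [htdef]; field_simp
  have htle : t ≤ 1 / 2 := by
    rw [htdef]
    apply one_div_le_one_div_of_le <;> linarith [(Nat.cast_nonneg n : (0 : ℝ) ≤ n)]
  have hlt : 5 * (1 + L) * t < L := by
    have hn' : (N : ℝ) ≤ n + 2 := by exact_mod_cast hn
    have : 5 * (1 + L) / L < n + 2 := lt_of_lt_of_le hN hn'
    rw [div_lt_iff₀ hL] at this
    rw [htdef, mul_one_div, div_lt_iff₀ hn2]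
    linarith
  have hre := re_aux L t hL ht (by linarith) hlt
  set u : ℂ := ((L * t : ℝ) : ℂ) + ((Real.pi * t : ℝ) : ℂ) * Complex.I with hu
  have hure : u.re = L * t := by simp [hu]
  have huim : u.im = Real.pi * t := by simp [hu]
  have hw : Complex.exp u ^ (n + 2) = -(m : ℂ) := by
    rw [← Complex.exp_nat_mul]
    have ht2c : (t : ℂ) * (n + 2) = 1 := by exact_mod_cast ht2
    have : ((n + 2 : ℕ) : ℂ) * u = (L : ℂ) + Real.pi * Complex.I := by
      rw [hu]; push_cast
      linear_combination ((L : ℂ) + Real.pi * Complex.I) * ht2c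
    rw [this, Complex.exp_add, Complex.exp_pi_mul_I, ← Complex.ofReal_exp, hLdef,
      Real.exp_log (by linarith)]
    ring
  have hw' : (starRingEnd ℂ) (Complex.exp u) ^ (n + 2) = -(m : ℂ) := by
    rw [← map_pow, hw]; simp
  have hz := mem_spec_aux n m _ hw
  have hz' := mem_spec_aux n m _ hw'
  have hzre : 0 < (Complex.exp u - 1).re := by
    rw [Complex.sub_re, Complex.exp_re, hure, huim, Complex.one_re]; linarith
  refine ⟨⟨_, hz, hzre⟩, _, hz, hzre, ?_, ?_⟩
  · rw [Complex.sub_im, Complex.exp_im, hure, huim, Complex.one_im, sub_zero]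
    have : 0 < Real.sin (Real.pi * t) :=
      Real.sin_pos_of_pos_of_lt_pi (by positivity) (by nlinarith [Real.pi_pos])
    positivity
  · simpa using hz'
end

section
/- For all positive real numbers k₁, k₂, k₃, the 3×3 real matrix G = [[0, −k₂, 0], [−k₃, −2k₂, 2k₁], [k₃, k₂, −k₁]] is hyperbolic: every complex eigenvalue of G has nonzero real part. (G is the Jacobian, evaluated at the unique positive steady state, of the mass-action Lotka–Volterra system X + Y → Z, Z → 2Y, Y → ∅, X → 2X obtained by splitting the infection reaction X + Y → 2Y through one intermediate Z; in particular its determinant equals −k₁k₂k₃ ≠ 0, and no purely imaginary eigenvalues occur for any choice of positive rate constants.) -/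
open Matrix

/-- For all positive reals `k₁, k₂, k₃`, the matrix
`G = [[0, −k₂, 0], [−k₃, −2k₂, 2k₁], [k₃, k₂, −k₁]]` (the steady-state Jacobian of the
Lotka–Volterra system with one intermediate) is hyperbolic: every complex eigenvalue of `G`
has nonzero real part. -/
theorem lotkaVolterra_intermediate_hyperbolic (k₁ k₂ k₃ : ℝ)
    (h₁ : 0 < k₁) (h₂ : 0 < k₂) (h₃ : 0 < k₃) :
    ∀ z ∈ spec !![(0 : ℝ), -k₂, 0; -k₃, -2 * k₂, 2 * k₁; k₃, k₂, -k₁], z.re ≠ 0 := by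
  intro z hz hre
  unfold spec at hz
  have h := Polynomial.isRoot_of_mem_roots hz
  rw [Polynomial.IsRoot, Matrix.eval_charpoly, Matrix.det_fin_three] at h
  simp [Matrix.scalar_apply] at h
  have hz' : z = (z.im : ℂ) * Complex.I := by
    apply Complex.ext <;> simp [hre]
  generalize z.im = y at hz'
  subst hz'
  have hr := congrArg Complex.re h
  have hi := congrArg Complex.im h
  simp at hr hi
  have h23 : 0 < k₂ * k₃ := mul_pos h₂ h₃
  have h123 : 0 < k₁ * (k₂ * k₃) := mul_pos h₁ h23
  have hy : y * (y ^ 2 + k₂ * k₃) = 0 := by linarith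
  have hy0 : y = 0 := by
    rcases mul_eq_zero.mp hy with h | h
    · exact h
    · nlinarith [sq_nonneg y]
  subst hy0
  nlinarith
end
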